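/- arXiv:1407.4712 — 2 statements merged into one kernel-verified Lean document; each statement's English description precedes it below -/
import Mathlib

section
/- Let Δ be a right angled building of type (W,S) (the off-diagonal entries of M lie in {2, ∞}) and let T ⊆ B. For a T-residue R, let proj_R(D) denote the unique chamber of R minimizing ℓ(δ · D) over R (the gate of D in R, which exists and is unique). Call two T-residues R₁, R₂ parallel if proj_{R₂} restricted to R₁ and proj_{R₁} restricted to R₂ are mutually inverse bijections between R₁ and R₂. Then parallelism is an equivalence relation on the set of T-residues of Δ; in particular it is transitive. -/
section ParallelResidues

variable {B : Type*} {W : Type*} [Group W] {M : CoxeterMatrix B}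

/-- `IsGate cs δ R D C` means that `C` is a gate (projection) of the chamber `D` in the set of
chambers `R`: `C` belongs to `R` and minimizes `ℓ (δ · D)` over `R`. -/
def IsGate (cs : CoxeterSystem M W) {Δ : Type*} (δ : Δ → Δ → W)
    (R : Set Δ) (D C : Δ) : Prop :=
  C ∈ R ∧ ∀ D' ∈ R, cs.length (δ C D) ≤ cs.length (δ D' D)

/-- Two sets of chambers `R₁`, `R₂` are *parallel* if the projection to `R₂` restricted to `R₁`
and the projection to `R₁` restricted to `R₂` are mutually inverse bijections between `R₁` and
`R₂`: whenever `D` is the gate of a chamber `C ∈ R₁` in `R₂` then `C` is the gate of `D` in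
`R₁`, and vice versa. -/
def Parallel (cs : CoxeterSystem M W) {Δ : Type*} (δ : Δ → Δ → W)
    (R₁ R₂ : Set Δ) : Prop :=
  (∀ C ∈ R₁, ∀ D : Δ, IsGate cs δ R₂ C D → IsGate cs δ R₁ D C) ∧
  (∀ D ∈ R₂, ∀ C : Δ, IsGate cs δ R₁ D C → IsGate cs δ R₂ C D)

theorem exists_minimal_length_aux {B : Type*} {W : Type*} [Group W] {M : CoxeterMatrix B}
    (cs : CoxeterSystem M W) (G : Subgroup W) (w : W) :
    ∃ q : G, ∀ q' : G, cs.length (w * q) ≤ cs.length (w * q') :=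
  ⟨Function.argmin (fun q : G => cs.length (w * q)),
    fun other => Function.argmin_le (fun q : G => cs.length (w * q)) other⟩

/-! ### Coxeter group part -/

/-- Retraction onto a standard parabolic subgroup of a right angled Coxeter group. -/
theorem ra_exists_ret {B : Type*} {W : Type*} [Group W] {M : CoxeterMatrix B}
    (cs : CoxeterSystem M W) (hra : ∀ i j : B, i ≠ j → M i j = 2 ∨ M i j = 0) (J : Set B) :
    ∃ φ : W →* W, (∀ i ∈ J, φ (cs.simple i) = cs.simple i) ∧
      (∀ i, i ∉ J → φ (cs.simple i) = 1) := by
  classical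
  have hl : M.IsLiftable (fun i => if i ∈ J then cs.simple i else 1) := by
    intro i j
    by_cases hij : i = j
    · subst hij
      by_cases hi : i ∈ J <;> simp [hi]
    · by_cases hi : i ∈ J <;> by_cases hj : j ∈ J <;> simp only [hi, hj, if_true, if_false]
      · exact cs.simple_mul_simple_pow i j
      · rcases hra i j hij with h | h <;> simp [h]
      · rcases hra i j hij with h | h <;> simp [h]
      · simp
  refine ⟨cs.lift ⟨_, hl⟩, ?_, ?_⟩
  · intro i hi
    rw [cs.lift_apply_simple hl]; simp [hi]
  · intro i hi
    rw [cs.lift_apply_simple hl]; simp [hi]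

theorem cox_word_mem {B : Type*} {W : Type*} [Group W] {M : CoxeterMatrix B}
    (cs : CoxeterSystem M W) (T : Set B) (ω : List B) (h : ∀ i ∈ ω, i ∈ T) :
    cs.wordProd ω ∈ Subgroup.closure (cs.simple '' T) := by
  induction ω with
  | nil => simp
  | cons i ω ih =>
    rw [cs.wordProd_cons]
    refine Subgroup.mul_mem _ (Subgroup.subset_closure ⟨i, h i (by simp), rfl⟩) (ih ?_)
    intro j hj
    exact h j (by simp [hj])

theorem cox_exists_word {B : Type*} {W : Type*} [Group W] {M : CoxeterMatrix B}
    (cs : CoxeterSystem M W) (T : Set B) (u : W)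
    (hu : u ∈ Subgroup.closure (cs.simple '' T)) :
    ∃ ω : List B, (∀ i ∈ ω, i ∈ T) ∧ cs.wordProd ω = u := by
  induction hu using Subgroup.closure_induction with
  | mem x hx =>
    obtain ⟨i, hi, rfl⟩ := hx
    exact ⟨[i], by simpa using hi, by simp⟩
  | one => exact ⟨[], by simp, by simp⟩
  | mul x y _ _ hx hy =>
    obtain ⟨a, ha, rfl⟩ := hx
    obtain ⟨b, hb, rfl⟩ := hy
    refine ⟨a ++ b, ?_, cs.wordProd_append a b⟩
    intro i hi
    rcases List.mem_append.1 hi with h | h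
    · exact ha i h
    · exact hb i h
  | inv x _ hx =>
    obtain ⟨a, ha, rfl⟩ := hx
    exact ⟨a.reverse, by simpa using ha, by simp⟩

/-- Image of a word under a retraction is the filtered word. -/
theorem ra_ret_word {B : Type*} {W : Type*} [Group W] {M : CoxeterMatrix B}
    (cs : CoxeterSystem M W) (J : Set B) (φ : W →* W)
    (h1 : ∀ i ∈ J, φ (cs.simple i) = cs.simple i)
    (h2 : ∀ i, i ∉ J → φ (cs.simple i) = 1) (ω : List B) :
    ∃ ω' : List B, ω'.length ≤ ω.length ∧ (∀ i ∈ ω', i ∈ J) ∧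
      φ (cs.wordProd ω) = cs.wordProd ω' := by
  induction ω with
  | nil => exact ⟨[], by simp, by simp, by simp⟩
  | cons i ω ih =>
    obtain ⟨ω', a, b, c⟩ := ih
    by_cases hi : i ∈ J
    · refine ⟨i :: ω', by simpa using a, ?_, ?_⟩
      · intro j hj
        rcases List.mem_cons.1 hj with rfl | hj
        · exact hi
        · exact b j hj
      · rw [cs.wordProd_cons, cs.wordProd_cons, map_mul, h1 i hi, c]
    · refine ⟨ω', by simp; omega, b, ?_⟩
      rw [cs.wordProd_cons, map_mul, h2 i hi, c, one_mul]

theorem ra_ret_fix {B : Type*} {W : Type*} [Group W] {M : CoxeterMatrix B}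
    (cs : CoxeterSystem M W) (J : Set B) (φ : W →* W)
    (h1 : ∀ i ∈ J, φ (cs.simple i) = cs.simple i) (u : W)
    (hu : u ∈ Subgroup.closure (cs.simple '' J)) : φ u = u := by
  induction hu using Subgroup.closure_induction with
  | mem x hx => obtain ⟨i, hi, rfl⟩ := hx; exact h1 i hi
  | one => simp
  | mul x y _ _ hx hy => rw [map_mul, hx, hy]
  | inv x _ hx => rw [map_inv, hx]

theorem ra_ret_kill {B : Type*} {W : Type*} [Group W] {M : CoxeterMatrix B}
    (cs : CoxeterSystem M W) (J K : Set B) (φ : W →* W)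
    (h2 : ∀ i, i ∉ J → φ (cs.simple i) = 1) (hK : ∀ i ∈ K, i ∉ J) (u : W)
    (hu : u ∈ Subgroup.closure (cs.simple '' K)) : φ u = 1 := by
  induction hu using Subgroup.closure_induction with
  | mem x hx => obtain ⟨i, hi, rfl⟩ := hx; exact h2 i (hK i hi)
  | one => simp
  | mul x y _ _ hx hy => rw [map_mul, hx, hy, one_mul]
  | inv x _ hx => rw [map_inv, hx, inv_one]

/-- Elements of a parabolic have reduced words in its letters. -/
theorem ra_exists_reduced {B : Type*} {W : Type*} [Group W] {M : CoxeterMatrix B}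
    (cs : CoxeterSystem M W) (hra : ∀ i j : B, i ≠ j → M i j = 2 ∨ M i j = 0) (J : Set B)
    (u : W) (hu : u ∈ Subgroup.closure (cs.simple '' J)) :
    ∃ ω : List B, (∀ i ∈ ω, i ∈ J) ∧ cs.IsReduced ω ∧ u = cs.wordProd ω := by
  obtain ⟨φ, h1, h2⟩ := ra_exists_ret cs hra J
  obtain ⟨ω, hω, rfl⟩ := cs.exists_isReduced u
  obtain ⟨ω', a, b, c⟩ := ra_ret_word cs J φ h1 h2 ω
  rw [ra_ret_fix cs J φ h1 _ hu] at c
  refine ⟨ω', b, ?_, c⟩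
  have := cs.length_wordProd_le ω'
  unfold CoxeterSystem.IsReduced at *
  rw [← c] at *
  omega

theorem ra_length_le {B : Type*} {W : Type*} [Group W] {M : CoxeterMatrix B}
    (cs : CoxeterSystem M W) (hra : ∀ i j : B, i ≠ j → M i j = 2 ∨ M i j = 0) (J K : Set B)
    (hK : ∀ i ∈ K, i ∉ J) (u v : W) (hu : u ∈ Subgroup.closure (cs.simple '' K))
    (hv : v ∈ Subgroup.closure (cs.simple '' J)) : cs.length v ≤ cs.length (u * v) := by
  obtain ⟨φ, h1, h2⟩ := ra_exists_ret cs hra J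
  obtain ⟨ω, hω, hw⟩ := cs.exists_isReduced (u * v)
  obtain ⟨ω', a, b, c⟩ := ra_ret_word cs J φ h1 h2 ω
  rw [← hw, map_mul, ra_ret_fix cs J φ h1 _ hv, ra_ret_kill cs J K φ h2 hK _ hu, one_mul] at c
  have := cs.length_wordProd_le ω'
  unfold CoxeterSystem.IsReduced at *
  rw [hw, c]
  omega

theorem ra_comm {B : Type*} {W : Type*} [Group W] {M : CoxeterMatrix B}
    (cs : CoxeterSystem M W) (i j : B) (h : M i j = 2) :
    cs.simple i * cs.simple j = cs.simple j * cs.simple i := by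
  have h1 := cs.simple_mul_simple_pow i j
  rw [h, pow_two] at h1
  have := eq_inv_of_mul_eq_one_left h1
  simpa using this

/-- The inversion cocycle. -/
theorem ra_exists_cocycle {B : Type*} {W : Type*} [Group W] {M : CoxeterMatrix B}
    (cs : CoxeterSystem M W) (hra : ∀ i j : B, i ≠ j → M i j = 2 ∨ M i j = 0) :
    ∃ N : W → W → ZMod 2, (∀ x y r, N (x * y) r = N y r + N x (y * r * y⁻¹)) ∧
      (∀ i r, r ≠ cs.simple i → N (cs.simple i) r = 0) ∧
      (∀ i, N (cs.simple i) (cs.simple i) = 1) := by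
  classical
  let f : B → Function.End (W × ZMod 2) := fun i p =>
    (cs.simple i * p.1 * cs.simple i, p.2 + if p.1 = cs.simple i then 1 else 0)
  have hff : ∀ i, f i * f i = 1 := by
    intro i
    funext p
    obtain ⟨r, e⟩ := p
    change f i (f i (r, e)) = (r, e)
    have : cs.simple i * r * cs.simple i = cs.simple i ↔ r = cs.simple i := by
      constructor
      · intro h
        have h2 : cs.simple i * (cs.simple i * r * cs.simple i) * cs.simple i = cs.simple i := by
          rw [h]; simp
        simpa [mul_assoc] using h2
      · rintro rfl; simp
    simp only [f, this]
    ext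
    · simp [mul_assoc]
    · by_cases h : r = cs.simple i
      · simp only [h, if_true]; rw [add_assoc]; 
        have : (1 + 1 : ZMod 2) = 0 := by decide
        rw [this, add_zero]
      · simp [h]
  have hcomm : ∀ i j, M i j = 2 → f i * f j = f j * f i := by
    intro i j hij
    have hc := ra_comm cs i j hij
    have key : ∀ i j, cs.simple i * cs.simple j = cs.simple j * cs.simple i → ∀ r,
        (cs.simple j * r * cs.simple j = cs.simple i ↔ r = cs.simple i) := by
      intro i j hc r
      constructor
      · intro h
        have h2 : cs.simple j * (cs.simple j * r * cs.simple j) * cs.simple j = cs.simple i := by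
          rw [h, ← hc]; simp
        simpa [mul_assoc] using h2
      · rintro rfl; rw [← hc]; simp
    funext p
    obtain ⟨r, e⟩ := p
    change f i (f j (r, e)) = f j (f i (r, e))
    simp only [f, key i j hc r, key j i hc.symm r]
    ext
    · simp only
      calc _ = (cs.simple i * cs.simple j) * r * (cs.simple j * cs.simple i) := by group
        _ = _ := by rw [hc]; simp only [mul_assoc, hc]
    · simp only; abel_nf
  have hl : M.IsLiftable f := by
    intro i j
    by_cases hij : i = j
    · subst hij; rw [hff]; simp
    · rcases hra i j hij with h | h
      · rw [h, pow_two]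
        calc f i * f j * (f i * f j) = f i * f j * (f j * f i) := by rw [hcomm i j h]
          _ = f i * (f j * f j) * f i := by simp only [mul_assoc]
          _ = 1 := by rw [hff, mul_one, hff]
      · rw [h, pow_zero]
  let A := cs.lift ⟨f, hl⟩
  have hA : ∀ i, A (cs.simple i) = f i := fun i => cs.lift_apply_simple hl i
  have key : ∀ w r e, A w (r, e) = (w * r * w⁻¹, e + (A w (r, 0)).2) := by
    intro w
    induction w using cs.simple_induction_left with
    | one =>
      intro r e
      rw [map_one]
      change (r, e) = (_, e + 0)
      simp
    | mul_simple_left w i ih =>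
      intro r e
      rw [map_mul]
      change A (cs.simple i) (A w (r, e)) = (_, e + (A (cs.simple i) (A w (r, 0))).2)
      rw [ih r e, ih r 0, hA]
      simp only [f]
      ext
      · simp [mul_assoc]
      · simp only; abel_nf
  refine ⟨fun w r => (A w (r, 0)).2, ?_, ?_, ?_⟩
  · intro x y r
    simp only
    rw [map_mul]
    change (A x (A y (r, 0))).2 = _
    rw [key y r 0, key x, zero_add]
  · intro i r h
    simp only
    rw [hA]
    simp [f, h]
  · intro i
    simp only
    rw [hA]
    simp [f]

/-- Everything we need about the inversion cocycle. -/
theorem ra_exists_cocycle' {B : Type*} {W : Type*} [Group W] {M : CoxeterMatrix B}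
    (cs : CoxeterSystem M W) (hra : ∀ i j : B, i ≠ j → M i j = 2 ∨ M i j = 0) :
    ∃ N : W → W → ZMod 2, (∀ x y r, N (x * y) r = N y r + N x (y * r * y⁻¹)) ∧
      (∀ i r, r ≠ cs.simple i → N (cs.simple i) r = 0) ∧
      (∀ w r, N w r ≠ 0 → cs.length (w * r) < cs.length w) ∧
      (∀ w i, cs.length (w * cs.simple i) < cs.length w → N w (cs.simple i) = 1) := by
  obtain ⟨N, h1, h2, h3⟩ := ra_exists_cocycle cs hra
  have hone : ∀ r, N 1 r = 0 := by
    intro r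
    have := h1 1 1 r
    simpa using this
  have hw : ∀ (ω : List B) (r : W), N (cs.wordProd ω) r ≠ 0 → r ∈ cs.rightInvSeq ω := by
    intro ω
    induction ω with
    | nil => intro r h; exact absurd (by simpa using hone r) h
    | cons i ω ih =>
      intro r h
      rw [cs.wordProd_cons, h1] at h
      rw [CoxeterSystem.rightInvSeq, List.mem_cons]
      by_cases hr : N (cs.wordProd ω) r = 0
      · left
        by_contra hne
        apply h
        rw [hr, zero_add]
        apply h2
        intro he
        apply hne
        rw [← he]; group
      · right; exact ih r hr
  have h4 : ∀ w r, N w r ≠ 0 → cs.length (w * r) < cs.length w := by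
    intro w r h
    obtain ⟨ω, hω, rfl⟩ := cs.exists_isReduced w
    exact (cs.isRightInversion_of_mem_rightInvSeq hω (hw ω r h)).2
  refine ⟨N, h1, h2, h4, ?_⟩
  intro w i hlt
  by_contra hne
  have h0 : ∀ a : ZMod 2, a ≠ 1 → a = 0 := by decide
  have hz := h0 _ hne
  have h5 := h1 (w * cs.simple i) (cs.simple i) (cs.simple i)
  rw [cs.simple_mul_simple_cancel_right, hz, h3] at h5
  simp only [cs.inv_simple, cs.simple_mul_simple_cancel_right] at h5
  have h6 : N (w * cs.simple i) (cs.simple i) ≠ 0 := by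
    intro h; rw [h] at h5; revert h5; decide
  have := h4 _ _ h6
  rw [cs.simple_mul_simple_cancel_right] at this
  omega

/-- Elements of the infinite dihedral group, indexed by integers. -/
theorem ra_dihedral {B : Type*} {W : Type*} [Group W] {M : CoxeterMatrix B}
    (cs : CoxeterSystem M W) (hra : ∀ i j : B, i ≠ j → M i j = 2 ∨ M i j = 0)
    (i t : B) (hit : i ≠ t) (h0 : M i t = 0) (p : W)
    (hp : p ∈ Subgroup.closure (cs.simple '' {i, t})) :
    cs.length p < cs.length (p * cs.simple i) ∨ cs.length p < cs.length (p * cs.simple t) := by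
  classical
  let f : B → Equiv.Perm ℤ := fun j =>
    if j = i then Equiv.subLeft 1 else if j = t then Equiv.subLeft (-1) else 1
  have fi : f i = Equiv.subLeft 1 := by simp [f]
  have ft : f t = Equiv.subLeft (-1) := by simp [f, Ne.symm hit]
  have fo : ∀ j, j ≠ i → j ≠ t → f j = 1 := by intro j a b; simp [f, a, b]
  have fsq : ∀ j, f j * f j = 1 := by
    intro j
    by_cases a : j = i
    · subst a; rw [fi]; ext x; simp
    · by_cases b : j = t
      · subst b; rw [ft]; ext x; simp
      · rw [fo j a b, one_mul]
  have hl : M.IsLiftable f := by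
    intro j k
    by_cases hjk : j = k
    · subst hjk; rw [fsq]; simp
    · rcases hra j k hjk with h | h
      · rw [h, pow_two]
        by_cases hj : j = i ∨ j = t
        · have hk : f k = 1 := by
            apply fo
            · rintro rfl
              rcases hj with rfl | rfl
              · exact hjk rfl
              · rw [M.symmetric] at h; omega
            · rintro rfl
              rcases hj with rfl | rfl
              · omega
              · exact hjk rfl
          rw [hk, mul_one, fsq]
        · push Not at hj
          rw [fo j hj.1 hj.2, one_mul, fsq]
      · rw [h, pow_zero]
  let A := cs.lift ⟨f, hl⟩
  have hA : ∀ i, A (cs.simple i) = f i := fun i => cs.lift_apply_simple hl i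
  have hlow : ∀ w : W, |A w 0| ≤ cs.length w := by
    intro w
    obtain ⟨ω, hω, rfl⟩ := cs.exists_isReduced w
    rw [hω.eq]
    clear hω
    induction ω with
    | nil => simp
    | cons j ω ih =>
      rw [cs.wordProd_cons, map_mul, hA, Equiv.Perm.mul_apply]
      have : |f j (A (cs.wordProd ω) 0)| ≤ |A (cs.wordProd ω) 0| + 1 := by
        by_cases a : j = i
        · subst a; rw [fi]; simp only [Equiv.subLeft_apply]; grind
        · by_cases b : j = t
          · subst b; rw [ft]; simp only [Equiv.subLeft_apply]; grind
          · rw [fo j a b]; simp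
      simp only [List.length_cons]
      push_cast
      omega
  let P : ℤ → W := fun k => (cs.simple i * cs.simple t) ^ k
  have hPadd : ∀ k, P (k + 1) = P k * (cs.simple i * cs.simple t) := fun k => zpow_add_one _ k
  have hPsub : ∀ k, P (k - 1) = P k * (cs.simple t * cs.simple i) := by
    intro k
    have := zpow_sub_one (cs.simple i * cs.simple t) k
    simpa [P] using this
  have hAP : ∀ k x, A (P k) x = x + 2 * k := by
    intro k
    induction k using Int.induction_on with
    | zero => intro x; simp [P]
    | succ n ih =>
      intro x
      rw [hPadd, map_mul, map_mul, hA, hA, Equiv.Perm.mul_apply, Equiv.Perm.mul_apply, ih, fi, ft]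
      simp only [Equiv.subLeft_apply]; ring
    | pred n ih =>
      intro x
      rw [hPsub, map_mul, map_mul, hA, hA, Equiv.Perm.mul_apply, Equiv.Perm.mul_apply, ih, fi, ft]
      simp only [Equiv.subLeft_apply]; ring
  have hPpos : ∀ n : ℕ, cs.length (P n) ≤ 2 * n := by
    intro n
    induction n with
    | zero => simp [P]
    | succ n ih =>
      push_cast
      rw [hPadd]
      have h1 := cs.length_mul_le (P n) (cs.simple i * cs.simple t)
      have h2 := cs.length_mul_le (cs.simple i) (cs.simple t)
      simp only [cs.length_simple] at h2
      omega
  have hPle : ∀ k : ℤ, cs.length (P k) ≤ 2 * |k| := by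
    intro k
    rcases Int.eq_nat_or_neg k with ⟨n, rfl | rfl⟩
    · have := hPpos n; simp; omega
    · have : P (-n) = (P n)⁻¹ := zpow_neg _ _
      rw [this, cs.length_inv]
      have := hPpos n; simp; omega
  have hQle : ∀ k : ℤ, cs.length (P k * cs.simple i) ≤ |2 * k + 1| := by
    intro k
    by_cases hk : 0 ≤ k
    · have h1 := cs.length_mul_le (P k) (cs.simple i)
      have h2 := hPle k
      rw [cs.length_simple] at h1
      rw [abs_of_nonneg hk] at h2
      rw [abs_of_nonneg (by omega)]
      omega
    · have h3 : P k * cs.simple i = P (k + 1) * cs.simple t := by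
        rw [hPadd]; simp [mul_assoc]
      rw [h3]
      have h1 := cs.length_mul_le (P (k + 1)) (cs.simple t)
      have h2 := hPle (k + 1)
      rw [cs.length_simple] at h1
      rw [abs_of_nonpos (by omega)] at h2
      rw [abs_of_nonpos (by omega)]
      omega
  have hcl : ∃ k, p = P k ∨ p = P k * cs.simple i := by
    obtain ⟨ω, hω, rfl⟩ := cox_exists_word cs _ p hp
    clear hp
    induction ω using List.reverseRecOn with
    | nil => exact ⟨0, Or.inl (by simp [P])⟩
    | append_singleton ω j ih =>
      obtain ⟨k, hk⟩ := ih (fun j hj => hω j (by simp [hj]))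
      have hj := hω j (by simp)
      rw [cs.wordProd_append, cs.wordProd_singleton]
      rcases hj with rfl | hj
      · rcases hk with hk | hk <;> rw [hk]
        · exact ⟨k, Or.inr rfl⟩
        · exact ⟨k, Or.inl (by simp)⟩
      · have hj : j = t := hj
        subst hj
        rcases hk with hk | hk <;> rw [hk]
        · exact ⟨k - 1, Or.inr (by rw [hPsub]; simp [mul_assoc])⟩
        · exact ⟨k + 1, Or.inl (by rw [hPadd]; simp [mul_assoc])⟩
  obtain ⟨k, hk⟩ := hcl
  have l1 := hlow (p * cs.simple i)
  have l2 := hlow (p * cs.simple t)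
  rw [map_mul, hA, Equiv.Perm.mul_apply] at l1 l2
  rw [fi] at l1
  rw [ft] at l2
  simp only [Equiv.subLeft_apply] at l1 l2
  rcases hk with hk | hk
  · have h := hPle k
    rw [← hk] at h
    rw [hk, hAP, ← hk] at l1 l2
    rcases abs_cases k with ⟨a, _⟩ | ⟨a, _⟩ <;> rw [a] at h <;> rw [abs_le] at l1 l2 <;> omega
  · have h := hQle k
    rw [← hk] at h
    rw [hk, map_mul, hA, Equiv.Perm.mul_apply, hAP, fi, ← hk] at l1 l2
    simp only [Equiv.subLeft_apply] at l1 l2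
    rcases abs_cases (2 * k + 1) with ⟨a, _⟩ | ⟨a, _⟩ <;> rw [a] at h <;>
      rw [abs_le] at l1 l2 <;> omega

/-- Two right descents commute. -/
theorem ra_descents {B : Type*} {W : Type*} [Group W] {M : CoxeterMatrix B}
    (cs : CoxeterSystem M W) (hra : ∀ i j : B, i ≠ j → M i j = 2 ∨ M i j = 0)
    (i t : B) (hit : i ≠ t) (w : W) (hi : cs.length (w * cs.simple i) < cs.length w)
    (ht : cs.length (w * cs.simple t) < cs.length w) : M i t = 2 := by
  rcases hra i t hit with h | h0
  · exact h
  exfalso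
  obtain ⟨N, h1, h2, h3, h4⟩ := ra_exists_cocycle' cs hra
  set G := Subgroup.closure (cs.simple '' {i, t}) with hG
  have mi : cs.simple i ∈ G := Subgroup.subset_closure ⟨i, by simp, rfl⟩
  have mt : cs.simple t ∈ G := Subgroup.subset_closure ⟨t, by simp, rfl⟩
  obtain ⟨q, hq⟩ := exists_minimal_length_aux cs G w
  have hN : ∀ s ∈ G, N w s = N (q : W)⁻¹ s := by
    intro s hs
    have e : w = (w * q) * (q : W)⁻¹ := by group
    rw [e, h1]
    have : N (w * q) ((q : W)⁻¹ * s * (q : W)⁻¹⁻¹) = 0 := by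
      by_contra hne
      have h5 := h3 _ _ hne
      have hm : (q : W) * ((q : W)⁻¹ * s * (q : W)⁻¹⁻¹) ∈ G := by
        have : (q : W) * ((q : W)⁻¹ * s * (q : W)⁻¹⁻¹) = s * q := by group
        rw [this]; exact G.mul_mem hs q.2
      have h6 := hq ⟨_, hm⟩
      simp only [← mul_assoc] at h5 h6
      omega
    rw [this, add_zero]
  have hp := G.inv_mem q.2
  have e1 := h3 _ _ (by rw [← hN _ mi, h4 w i hi]; decide)
  have e2 := h3 _ _ (by rw [← hN _ mt, h4 w t ht]; decide)
  rcases ra_dihedral cs hra i t hit h0 _ hp with h | h <;> omega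

/-- Minimal coset representatives that commute with `s_t` only involve letters commuting
with `t`. -/
theorem ra_centralizer {B : Type*} {W : Type*} [Group W] {M : CoxeterMatrix B}
    (cs : CoxeterSystem M W) (hra : ∀ i j : B, i ≠ j → M i j = 2 ∨ M i j = 0)
    (t : B) (ω : List B) (hω : cs.IsReduced ω)
    (hc : cs.wordProd ω * cs.simple t = cs.simple t * cs.wordProd ω)
    (hlt : cs.length (cs.wordProd ω) < cs.length (cs.wordProd ω * cs.simple t)) :
    ∀ i ∈ ω, M i t = 2 := by
  induction ω using List.reverseRecOn with
  | nil => simp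
  | append_singleton ω i ih =>
    have hω' : cs.IsReduced ω := by
      have := hω.take ω.length
      simpa using this
    have hl1 := hω.eq
    have hl2 := hω'.eq
    have hw : cs.wordProd (ω ++ [i]) = cs.wordProd ω * cs.simple i := by
      rw [cs.wordProd_append, cs.wordProd_singleton]
    rw [List.length_append, List.length_singleton] at hl1
    set x := cs.wordProd ω with hx
    set w := cs.wordProd (ω ++ [i]) with hw'
    have hxw : x = w * cs.simple i := by rw [hw]; simp
    have hit : i ≠ t := by
      rintro rfl
      rw [← hxw] at hlt
      omega
    have h2 : M i t = 2 := by
      apply ra_descents cs hra i t hit (w * cs.simple t)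
      · rw [hc, mul_assoc, ← hxw, ← hc]
        have := cs.length_mul_le (cs.simple t) x
        rw [cs.length_simple] at this
        omega
      · simpa using hlt
    have hcm := ra_comm cs i t h2
    have hxc : x * cs.simple t = cs.simple t * x := by
      rw [hxw, mul_assoc, hcm, ← mul_assoc, hc, mul_assoc]
    have hxl : cs.length x < cs.length (x * cs.simple t) := by
      have e : w * cs.simple t = x * cs.simple t * cs.simple i := by
        rw [hw, mul_assoc, hcm, mul_assoc]
      have := cs.length_mul_le (x * cs.simple t) (cs.simple i)
      rw [← e, cs.length_simple] at this
      omega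
    intro j hj
    rcases List.mem_append.1 hj with hj | hj
    · exact ih hω' hxc hxl j hj
    · simp at hj; subst hj; exact h2

/-- Group-theoretic core: if `w` is minimal in `w W_T`, `s_t w` is longer than `w` and is not
minimal in `s_t w W_T`, then `w` commutes with `s_t`. -/
theorem ra_core {B : Type*} {W : Type*} [Group W] {M : CoxeterMatrix B}
    (cs : CoxeterSystem M W) (hra : ∀ i j : B, i ≠ j → M i j = 2 ∨ M i j = 0)
    (T : Set B) (t : B) (ht : t ∈ T) (w : W)
    (hmin : ∀ u ∈ Subgroup.closure (cs.simple '' T), cs.length w ≤ cs.length (w * u))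
    (hnot : ∃ u ∈ Subgroup.closure (cs.simple '' T),
      cs.length (cs.simple t * w * u) < cs.length (cs.simple t * w)) :
    w * cs.simple t = cs.simple t * w := by
  obtain ⟨N, h1, h2, h3, h4⟩ := ra_exists_cocycle' cs hra
  set G := Subgroup.closure (cs.simple '' T) with hG
  set y := cs.simple t * w with hy
  obtain ⟨q, hq⟩ := exists_minimal_length_aux cs G y
  have hN : ∀ s ∈ G, N y s = N (q : W)⁻¹ s := by
    intro s hs
    have e : y = (y * q) * (q : W)⁻¹ := by group
    rw [e, h1]
    have : N (y * q) ((q : W)⁻¹ * s * (q : W)⁻¹⁻¹) = 0 := by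
      by_contra hne
      have h5 := h3 _ _ hne
      have hm : (q : W) * ((q : W)⁻¹ * s * (q : W)⁻¹⁻¹) ∈ G := by
        have : (q : W) * ((q : W)⁻¹ * s * (q : W)⁻¹⁻¹) = s * q := by group
        rw [this]; exact G.mul_mem hs q.2
      have h6 := hq ⟨_, hm⟩
      simp only [← mul_assoc] at h5 h6
      omega
    rw [this, add_zero]
  have hq1 : (q : W)⁻¹ ≠ 1 := by
    intro h
    have hq1 : (q : W) = 1 := inv_eq_one.1 h
    obtain ⟨u, hu, hl⟩ := hnot
    have := hq ⟨u, hu⟩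
    rw [hq1, mul_one] at this
    simp only at this
    omega
  obtain ⟨ω, hωT, hω, hqω⟩ := ra_exists_reduced cs hra T _ (G.inv_mem q.2)
  obtain ⟨t', ht', hlt⟩ : ∃ t' ∈ T, cs.length ((q : W)⁻¹ * cs.simple t') < cs.length (q : W)⁻¹ := by
    rcases List.eq_nil_or_concat ω with rfl | ⟨ω', t', rfl⟩
    · exact absurd (by simpa using hqω) hq1
    · refine ⟨t', hωT t' (by simp), ?_⟩
      rw [hqω, hω.eq, cs.wordProd_concat, cs.simple_mul_simple_cancel_right]
      have := cs.length_wordProd_le ω'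
      simp
      omega
  have ht'G : cs.simple t' ∈ G := Subgroup.subset_closure ⟨t', ht', rfl⟩
  have hN1 : N y (cs.simple t') = 1 := by rw [hN _ ht'G, h4 _ _ hlt]
  have hN0 : N w (cs.simple t') = 0 := by
    by_contra hne
    have := h3 _ _ hne
    have := hmin _ ht'G
    omega
  rw [hy, h1, hN0, zero_add] at hN1
  have hconj : w * cs.simple t' * w⁻¹ = cs.simple t := by
    by_contra hne
    rw [h2 _ _ hne] at hN1
    exact absurd hN1 (by decide)
  have hconj' : w * cs.simple t' = cs.simple t * w := by rw [← hconj]; group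
  by_cases htt : t' = t
  · rw [htt] at hconj'; exact hconj'
  · exfalso
    obtain ⟨φ, a, b⟩ := ra_exists_ret cs hra {t}
    have := congrArg φ hconj'
    rw [map_mul, map_mul, a t rfl, b t' htt, mul_one] at this
    have h1 : cs.simple t = 1 := by simpa using this.symm
    have := cs.length_simple t
    rw [h1, cs.length_one] at this
    omega

/-! ### Building part -/

theorem bld_symm_simple {B : Type*} {W : Type*} [Group W] {M : CoxeterMatrix B}
    (cs : CoxeterSystem M W) {Δ : Type*} (δ : Δ → Δ → W)
    (hWD1 : ∀ C D : Δ, δ C D = 1 ↔ C = D)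
    (hWD2 : ∀ (C C' D : Δ) (i : B), δ C' C = cs.simple i →
      (δ C' D = cs.simple i * δ C D ∨ δ C' D = δ C D) ∧
      (cs.length (cs.simple i * δ C D) = cs.length (δ C D) + 1 →
        δ C' D = cs.simple i * δ C D))
    (C C' : Δ) (i : B) (h : δ C' C = cs.simple i) : δ C C' = cs.simple i := by
  rcases (hWD2 C C' C' i h).1 with h1 | h1
  · rw [(hWD1 C' C').2 rfl] at h1
    have := eq_inv_of_mul_eq_one_right h1.symm
    simpa using this
  · rw [(hWD1 C' C').2 rfl] at h1
    have := (hWD1 C C').1 h1.symm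
    subst this
    rw [h] at h1
    have h2 := cs.length_simple i
    rw [← h1, cs.length_one] at h2
    omega

theorem bld_symm {B : Type*} {W : Type*} [Group W] {M : CoxeterMatrix B}
    (cs : CoxeterSystem M W) {Δ : Type*} (δ : Δ → Δ → W)
    (hWD1 : ∀ C D : Δ, δ C D = 1 ↔ C = D)
    (hWD2 : ∀ (C C' D : Δ) (i : B), δ C' C = cs.simple i →
      (δ C' D = cs.simple i * δ C D ∨ δ C' D = δ C D) ∧
      (cs.length (cs.simple i * δ C D) = cs.length (δ C D) + 1 →
        δ C' D = cs.simple i * δ C D))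
    (hWD3 : ∀ (C D : Δ) (i : B), ∃ C' : Δ,
      δ C' C = cs.simple i ∧ δ C' D = cs.simple i * δ C D)
    (C D : Δ) : δ D C = (δ C D)⁻¹ := by
  have key : ∀ ω : List B, ∀ C D E : Δ, δ C D = cs.wordProd ω →
      cs.length ((cs.wordProd ω)⁻¹ * δ C E) = ω.length + cs.length (δ C E) →
      δ D E = (cs.wordProd ω)⁻¹ * δ C E := by
    intro ω
    induction ω with
    | nil =>
      intro C D E h _
      rw [cs.wordProd_nil] at h
      rw [(hWD1 C D).1 h]; simp
    | cons i ω ih =>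
      intro C D E h hl
      obtain ⟨C', hC', hD⟩ := hWD3 C D i
      rw [h, cs.wordProd_cons, cs.simple_mul_simple_cancel_left] at hD
      have e : (cs.wordProd (i :: ω))⁻¹ * δ C E = (cs.wordProd ω)⁻¹ * (cs.simple i * δ C E) := by
        rw [cs.wordProd_cons]; simp [mul_assoc]
      rw [e] at hl ⊢
      have l1 := cs.length_mul_le (cs.wordProd ω)⁻¹ (cs.simple i * δ C E)
      have l2 := cs.length_wordProd_le ω
      have l3 := cs.length_mul_le (cs.simple i) (δ C E)
      rw [cs.length_inv] at l1
      rw [cs.length_simple] at l3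
      rw [List.length_cons] at hl
      have l4 : cs.length (cs.simple i * δ C E) = cs.length (δ C E) + 1 := by omega
      have hE := (hWD2 C C' E i hC').2 l4
      rw [← hE]
      apply ih C' D E hD
      rw [hE]
      omega
  obtain ⟨ω, hω, h⟩ := cs.exists_isReduced (δ C D)
  have h1 := key ω C D C h (by
    rw [(hWD1 C C).2 rfl]; simp [hω.eq])
  rw [h1, h, (hWD1 C C).2 rfl, mul_one]

theorem bld_left_coset {B : Type*} {W : Type*} [Group W] {M : CoxeterMatrix B}
    (cs : CoxeterSystem M W) {Δ : Type*} (δ : Δ → Δ → W)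
    (hWD1 : ∀ C D : Δ, δ C D = 1 ↔ C = D)
    (hWD2 : ∀ (C C' D : Δ) (i : B), δ C' C = cs.simple i →
      (δ C' D = cs.simple i * δ C D ∨ δ C' D = δ C D) ∧
      (cs.length (cs.simple i * δ C D) = cs.length (δ C D) + 1 →
        δ C' D = cs.simple i * δ C D))
    (hWD3 : ∀ (C D : Δ) (i : B), ∃ C' : Δ,
      δ C' C = cs.simple i ∧ δ C' D = cs.simple i * δ C D)
    (T : Set B) (C D E : Δ) (h : δ C D ∈ Subgroup.closure (cs.simple '' T)) :
    ∃ u ∈ Subgroup.closure (cs.simple '' T), δ C E = u * δ D E := by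
  obtain ⟨ω, hω, hw⟩ := cox_exists_word cs T _ h
  clear h
  induction ω generalizing C with
  | nil =>
    rw [cs.wordProd_nil] at hw
    rw [(hWD1 C D).1 hw.symm]
    exact ⟨1, Subgroup.one_mem _, by simp⟩
  | cons i ω ih =>
    obtain ⟨C', hC', hD⟩ := hWD3 C D i
    rw [← hw, cs.wordProd_cons, cs.simple_mul_simple_cancel_left] at hD
    obtain ⟨u, hu, he⟩ := ih C' (fun j hj => hω j (by simp [hj])) hD.symm
    have h2 := bld_symm_simple cs δ hWD1 hWD2 _ _ _ hC'
    rcases (hWD2 C' C E i h2).1 with h3 | h3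
    · refine ⟨cs.simple i * u, Subgroup.mul_mem _
        (Subgroup.subset_closure ⟨i, hω i (by simp), rfl⟩) hu, ?_⟩
      rw [h3, he, mul_assoc]
    · exact ⟨u, hu, by rw [h3, he]⟩

theorem bld_left_move {B : Type*} {W : Type*} [Group W] {M : CoxeterMatrix B}
    (cs : CoxeterSystem M W) {Δ : Type*} (δ : Δ → Δ → W)
    (hWD1 : ∀ C D : Δ, δ C D = 1 ↔ C = D)
    (hWD2 : ∀ (C C' D : Δ) (i : B), δ C' C = cs.simple i →
      (δ C' D = cs.simple i * δ C D ∨ δ C' D = δ C D) ∧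
      (cs.length (cs.simple i * δ C D) = cs.length (δ C D) + 1 →
        δ C' D = cs.simple i * δ C D))
    (hWD3 : ∀ (C D : Δ) (i : B), ∃ C' : Δ,
      δ C' C = cs.simple i ∧ δ C' D = cs.simple i * δ C D)
    (T : Set B) (D E : Δ) (u : W) (h : u ∈ Subgroup.closure (cs.simple '' T)) :
    ∃ C, δ C D ∈ Subgroup.closure (cs.simple '' T) ∧ δ C E = u * δ D E := by
  obtain ⟨ω, hω, rfl⟩ := cox_exists_word cs T _ h
  clear h
  induction ω with
  | nil => exact ⟨D, by rw [(hWD1 D D).2 rfl]; exact Subgroup.one_mem _, by simp⟩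
  | cons i ω ih =>
    obtain ⟨C, hC, he⟩ := ih (fun j hj => hω j (by simp [hj]))
    obtain ⟨C', hC', hE⟩ := hWD3 C E i
    refine ⟨C', ?_, by rw [hE, he, cs.wordProd_cons, mul_assoc]⟩
    rcases (hWD2 C C' D i hC').1 with h | h <;> rw [h]
    · exact Subgroup.mul_mem _ (Subgroup.subset_closure ⟨i, hω i (by simp), rfl⟩) hC
    · exact hC

theorem perp_comm {B : Type*} {W : Type*} [Group W] {M : CoxeterMatrix B}
    (cs : CoxeterSystem M W) (T : Set B) (u v : W)
    (hu : u ∈ Subgroup.closure (cs.simple '' T))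
    (hv : v ∈ Subgroup.closure (cs.simple '' {i | ∀ t ∈ T, M i t = 2})) : v * u = u * v := by
  have h1 : u ∈ Subgroup.centralizer ({v} : Set W) := by
    refine (Subgroup.closure_le _).2 ?_ hu
    rintro _ ⟨t, ht, rfl⟩
    have h2 : v ∈ Subgroup.centralizer ({cs.simple t} : Set W) := by
      refine (Subgroup.closure_le _).2 ?_ hv
      rintro _ ⟨i, hi, rfl⟩
      simp only [SetLike.mem_coe, Subgroup.mem_centralizer_singleton_iff]
      exact ra_comm cs i t (hi t ht)
    simp only [SetLike.mem_coe, Subgroup.mem_centralizer_singleton_iff] at h2 ⊢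
    first
      | exact h2
      | exact h2.symm
  rw [Subgroup.mem_centralizer_singleton_iff] at h1
  first
    | exact h1
    | exact h1.symm

/-- Let `Δ` be a right angled building of type `(W, S)` (the off-diagonal
entries of `M` lie in `{2, ∞}`, with `∞` encoded as `0`) and `T ⊆ B`. Then parallelism is an
equivalence relation on the set of `T`-residues of `Δ`; in particular it is transitive. -/
theorem parallelism_of_residues_equivalence (cs : CoxeterSystem M W)
    {Δ : Type*} [Nonempty Δ] (δ : Δ → Δ → W)
    (hWD1 : ∀ C D : Δ, δ C D = 1 ↔ C = D)
    (hWD2 : ∀ (C C' D : Δ) (i : B), δ C' C = cs.simple i →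
      (δ C' D = cs.simple i * δ C D ∨ δ C' D = δ C D) ∧
      (cs.length (cs.simple i * δ C D) = cs.length (δ C D) + 1 →
        δ C' D = cs.simple i * δ C D))
    (hWD3 : ∀ (C D : Δ) (i : B), ∃ C' : Δ,
      δ C' C = cs.simple i ∧ δ C' D = cs.simple i * δ C D)
    (hra : ∀ i j : B, i ≠ j → M i j = 2 ∨ M i j = 0)
    (T : Set B)
    (Res : Set (Set Δ))
    (hRes : Res = {R : Set Δ | ∃ C : Δ,
      R = {D : Δ | δ C D ∈ Subgroup.closure (cs.simple '' T)}}) :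
    (∀ R ∈ Res, Parallel cs δ R R) ∧
    (∀ R₁ ∈ Res, ∀ R₂ ∈ Res, Parallel cs δ R₁ R₂ → Parallel cs δ R₂ R₁) ∧
    (∀ R₁ ∈ Res, ∀ R₂ ∈ Res, ∀ R₃ ∈ Res,
      Parallel cs δ R₁ R₂ → Parallel cs δ R₂ R₃ → Parallel cs δ R₁ R₃) := by
  have hsym := bld_symm cs δ hWD1 hWD2 hWD3
  have hco := fun J => bld_left_coset cs δ hWD1 hWD2 hWD3 J
  have hmv := fun J => bld_left_move cs δ hWD1 hWD2 hWD3 J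
  have hself : ∀ C, δ C C = 1 := fun C => (hWD1 C C).2 rfl
  have hlen : ∀ C D, cs.length (δ C D) = cs.length (δ D C) := by
    intro C D; rw [hsym D C, cs.length_inv]
  have hcosymm : ∀ (J : Set B) C D, δ C D ∈ Subgroup.closure (cs.simple '' J) →
      δ D C ∈ Subgroup.closure (cs.simple '' J) := by
    intro J C D h; rw [hsym C D]; exact Subgroup.inv_mem _ h
  have hcotrans : ∀ (J : Set B) C D E, δ C D ∈ Subgroup.closure (cs.simple '' J) →
      δ D E ∈ Subgroup.closure (cs.simple '' J) → δ C E ∈ Subgroup.closure (cs.simple '' J) := by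
    intro J C D E h1 h2
    obtain ⟨u, hu, he⟩ := hco J C D E h1
    rw [he]; exact Subgroup.mul_mem _ hu h2
  have hcoR : ∀ (J : Set B) C D E, δ C D ∈ Subgroup.closure (cs.simple '' J) →
      ∃ u ∈ Subgroup.closure (cs.simple '' J), δ E C = δ E D * u := by
    intro J C D E h
    obtain ⟨u, hu, he⟩ := hco J C D E h
    exact ⟨u⁻¹, Subgroup.inv_mem _ hu, by rw [hsym C E, he, hsym D E, mul_inv_rev]⟩
  have hmvR : ∀ (J : Set B) D E u, u ∈ Subgroup.closure (cs.simple '' J) →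
      ∃ C, δ C D ∈ Subgroup.closure (cs.simple '' J) ∧ δ E C = δ E D * u := by
    intro J D E u hu
    obtain ⟨C, hC, he⟩ := hmv J D E u⁻¹ (Subgroup.inv_mem _ hu)
    exact ⟨C, hC, by rw [hsym C E, he, hsym D E, mul_inv_rev, inv_inv]⟩
  have hresmem : ∀ R ∈ Res, ∀ A ∈ R, ∀ D, D ∈ R ↔ δ A D ∈ Subgroup.closure (cs.simple '' T) := by
    intro R hR A hA D
    rw [hRes] at hR
    obtain ⟨C, rfl⟩ := hR
    exact ⟨fun h => hcotrans T _ _ _ (hcosymm T _ _ hA) h, fun h => hcotrans T _ _ _ hA h⟩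
  have hne : ∀ R ∈ Res, ∃ C, C ∈ R := by
    intro R hR
    rw [hRes] at hR
    obtain ⟨C, rfl⟩ := hR
    refine ⟨C, ?_⟩
    change δ C C ∈ Subgroup.closure (cs.simple '' T)
    rw [hself]; exact Subgroup.one_mem _
  have hgate : ∀ R ∈ Res, ∀ C, ∃ D, IsGate cs δ R C D := by
    intro R hR C
    obtain ⟨E, hE⟩ := hne R hR
    have : Nonempty R := ⟨⟨E, hE⟩⟩
    let m := Function.argmin (fun q : R => cs.length (δ q C))
    exact ⟨m, m.2, fun D' hD' => Function.argmin_le (fun q : R => cs.length (δ q C)) ⟨D', hD'⟩⟩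
  have lemA : ∀ R₁ ∈ Res, ∀ R₂ ∈ Res, Parallel cs δ R₁ R₂ → ∀ C ∈ R₁, ∀ D,
      IsGate cs δ R₂ C D →
      δ C D ∈ Subgroup.closure (cs.simple '' {i | ∀ t ∈ T, M i t = 2}) := by
    intro R₁ hR₁ R₂ hR₂ hpar C hC D hD
    have hCg := hpar.1 C hC D hD
    set w := δ C D with hw
    have hmin : ∀ u ∈ Subgroup.closure (cs.simple '' T), cs.length w ≤ cs.length (w * u) := by
      intro u hu
      obtain ⟨D', hD', he⟩ := hmvR T D C u hu
      rw [hw, ← he, hlen C D, hlen C D']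
      exact hD.2 D' ((hresmem R₂ hR₂ D hD.1 D').2 (hcosymm T _ _ hD'))
    have hcm : ∀ t ∈ T, w * cs.simple t = cs.simple t * w := by
      intro t ht
      apply ra_core cs hra T t ht w hmin
      by_contra hcon
      push Not at hcon
      obtain ⟨C', hC', he⟩ := hWD3 C D t
      rw [← hw] at he
      have hC'R : C' ∈ R₁ := (hresmem R₁ hR₁ C hC C').2 (hcosymm T _ _ (by
        rw [hC']; exact Subgroup.subset_closure ⟨t, ht, rfl⟩))
      have hg : IsGate cs δ R₂ C' D := by
        refine ⟨hD.1, fun D' hD' => ?_⟩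
        obtain ⟨u, hu, he'⟩ := hcoR T D' D C' (hcosymm T _ _ ((hresmem R₂ hR₂ D hD.1 D').1 hD'))
        rw [hlen D C', hlen D' C', he', he]
        exact hcon u hu
      have h1 := (hpar.1 C' hC'R D hg).2 C hC
      have h2 := hCg.2 C' hC'R
      rw [he, ← hw] at h1 h2
      exact cs.length_simple_mul_ne w t (le_antisymm h1 h2)
    obtain ⟨ω, hω, hwω⟩ := cs.exists_isReduced w
    rw [hwω]
    apply cox_word_mem
    intro i hi t ht
    refine ra_centralizer cs hra t ω hω ?_ ?_ i hi
    · rw [← hwω]; exact hcm t ht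
    · rw [← hwω]
      have h1 := hmin (cs.simple t) (Subgroup.subset_closure ⟨t, ht, rfl⟩)
      have h2 := cs.length_mul_simple_ne w t
      omega
  have lemB : ∀ R₁ ∈ Res, ∀ R₂ ∈ Res, ∀ C₁ ∈ R₁, ∀ C₂ ∈ R₂,
      δ C₁ C₂ ∈ Subgroup.closure (cs.simple '' {i | ∀ t ∈ T, M i t = 2}) →
      ∀ C ∈ R₁, ∀ D : Δ, IsGate cs δ R₂ C D → IsGate cs δ R₁ D C := by
    intro R₁ hR₁ R₂ hR₂ C₁ hC₁ C₂ hC₂ hv C hC D hD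
    set v := δ C₁ C₂ with hvdef
    have hcoset : ∀ A ∈ R₁, ∀ E ∈ R₂, ∃ u ∈ Subgroup.closure (cs.simple '' T),
        δ A E = u * v := by
      intro A hA E hE
      obtain ⟨u₁, hu₁, e₁⟩ := hco T A C₁ E ((hresmem R₁ hR₁ A hA C₁).1 hC₁)
      obtain ⟨u₂, hu₂, e₂⟩ := hcoR T E C₂ C₁ ((hresmem R₂ hR₂ E hE C₂).1 hC₂)
      refine ⟨u₁ * u₂, Subgroup.mul_mem _ hu₁ hu₂, ?_⟩
      rw [e₁, e₂, ← hvdef, perp_comm cs T u₂ v hu₂ hv, mul_assoc]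
    have hge : ∀ A ∈ R₁, ∀ E ∈ R₂, cs.length v ≤ cs.length (δ A E) := by
      intro A hA E hE
      obtain ⟨u, hu, e⟩ := hcoset A hA E hE
      rw [e]
      refine ra_length_le cs hra _ T ?_ u v hu hv
      intro i hi hi'
      have := hi' i hi
      rw [M.diagonal] at this
      omega
    have hle : cs.length (δ D C) ≤ cs.length v := by
      obtain ⟨u, hu, e⟩ := hcoset C hC D hD.1
      obtain ⟨D', hD', e'⟩ := hmvR T D C u⁻¹ (Subgroup.inv_mem _ hu)
      have h1 := hD.2 D' ((hresmem R₂ hR₂ D hD.1 D').2 (hcosymm T _ _ hD'))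
      rw [hlen D' C, e', e, ← perp_comm cs T u v hu hv, mul_inv_cancel_right] at h1
      exact h1
    refine ⟨hC, fun C' hC' => ?_⟩
    rw [hlen C D]
    exact hle.trans (hge C' hC' D hD.1)
  refine ⟨?_, ?_, ?_⟩
  · intro R hR
    have h : ∀ C ∈ R, ∀ D : Δ, IsGate cs δ R C D → IsGate cs δ R D C := by
      intro C hC D hD
      have h1 := hD.2 C hC
      rw [hself, cs.length_one] at h1
      have h2 := (hWD1 D C).1 (cs.length_eq_zero_iff.1 (Nat.le_zero.1 h1))
      subst h2
      exact hD
    exact ⟨h, h⟩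
  · intro R₁ _ R₂ _ h
    exact ⟨h.2, h.1⟩
  · intro R₁ hR₁ R₂ hR₂ R₃ hR₃ h12 h23
    obtain ⟨C₁, hC₁⟩ := hne R₁ hR₁
    obtain ⟨C₂, hC₂⟩ := hgate R₂ hR₂ C₁
    obtain ⟨C₃, hC₃⟩ := hgate R₃ hR₃ C₂
    have hv := hcotrans _ _ _ _ (lemA R₁ hR₁ R₂ hR₂ h12 C₁ hC₁ C₂ hC₂)
      (lemA R₂ hR₂ R₃ hR₃ h23 C₂ hC₂.1 C₃ hC₃)
    exact ⟨lemB R₁ hR₁ R₃ hR₃ C₁ hC₁ C₃ hC₃.1 hv,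
      lemB R₃ hR₃ R₁ hR₁ C₃ hC₃.1 C₁ hC₁ (hcosymm _ _ _ hv)⟩


end ParallelResidues
end

section
/- Let Δ be a regular right angled building of type (W,S) in which every panel is finite, let C₀ ∈ Δ, n : ℕ, and B_n = {C | ℓ(δ C₀ C) < n}. Then every automorphism of the combinatorial ball B_n fixing its center — i.e., every bijection g : B_n → B_n with g C₀ = C₀ and δ (g C) (g D) = δ C D for all C, D ∈ B_n — extends to an automorphism of the whole building: there exists a bijection G : Δ → Δ with δ (G C) (G D) = δ C D for all C, D ∈ Δ and G C = g C for all C ∈ B_n. -/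
namespace RAB

open CoxeterSystem

section Cox

variable {B : Type*} {W : Type*} [Group W] {M : CoxeterMatrix B} (cs : CoxeterSystem M W)

/-- right angled -/
def RA (M : CoxeterMatrix B) : Prop := ∀ i j : B, i ≠ j → M i j = 2 ∨ M i j = 0

open Classical in
theorem chi_exists (hra : RA M) (i : B) :
    ∃ χ : W →* Multiplicative (ZMod 2), ∀ j, χ (cs.simple j) =
      if j = i then Multiplicative.ofAdd 1 else 1 := by
  have hl : M.IsLiftable (fun j => if j = i then Multiplicative.ofAdd (1 : ZMod 2) else 1) := by
    intro j k
    by_cases h : j = k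
    · subst h
      rw [M.diagonal, pow_one]
      dsimp only
      split_ifs <;> rfl
    · rcases hra j k h with h2 | h2 <;> rw [h2]
      · dsimp only
        split_ifs <;> rfl
      · simp
  exact ⟨cs.lift ⟨_, hl⟩, fun j => cs.lift_apply_simple hl j⟩

theorem conj_simple_ne (hra : RA M) {i j : B} (h : i ≠ j) (u : W) :
    u * cs.simple i * u⁻¹ ≠ cs.simple j := by
  intro he
  obtain ⟨χ, hχ⟩ := chi_exists cs hra i
  have := congrArg χ he
  simp only [map_mul, map_inv, hχ, if_true, if_neg h.symm] at this
  rw [mul_comm (χ u), mul_assoc, mul_inv_cancel, mul_one] at this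
  exact absurd this (by decide)

theorem simple_ne (hra : RA M) {i j : B} (h : i ≠ j) : cs.simple i ≠ cs.simple j := by
  simpa using conj_simple_ne cs hra h 1

theorem simple_ne_one (i : B) : cs.simple i ≠ 1 := by
  intro h
  have := cs.length_simple i
  rw [h, cs.length_one] at this
  omega

theorem comm_of_two {i j : B} (h : M i j = 2) :
    cs.simple i * cs.simple j = cs.simple j * cs.simple i := by
  have := cs.simple_mul_simple_pow i j
  rw [h, pow_two] at this
  have h2 := eq_inv_of_mul_eq_one_left this
  rw [h2, mul_inv_rev, cs.inv_simple, cs.inv_simple]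

/-- infinite order -/
theorem pow_ne (hra : RA M) {i j : B} (h : i ≠ j) (hM : M i j = 0) {k : ℤ}
    (hk : (cs.simple i * cs.simple j) ^ k = 1) : k = 0 := by
  classical
  let a : Equiv.Perm ℤ := Equiv.neg ℤ
  let b : Equiv.Perm ℤ := Equiv.subLeft 1
  have ha : a * a = 1 := by ext x; simp [a]
  have hb : b * b = 1 := by ext x; simp [b]
  have hM' : M j i = 0 := by rw [M.symmetric]; exact hM
  have hl : M.IsLiftable (fun l => if l = i then a else if l = j then b else 1) := by
    intro l m
    by_cases hlm : l = m
    · subst hlm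
      rw [M.diagonal, pow_one]
      dsimp only
      split_ifs <;> simp [ha, hb]
    · rcases hra l m hlm with h2 | h2 <;> rw [h2]
      · dsimp only
        rw [pow_two]
        split_ifs with h3 h4 h5 h4 h5 h6 <;> simp_all
      · simp
  have h1 := cs.lift_apply_simple hl
  have h2 := congrArg (cs.lift ⟨_, hl⟩) hk
  rw [map_zpow, map_mul, h1, h1, map_one] at h2
  simp only [if_true, if_neg h.symm] at h2
  have hz : ∀ (n : ℕ) (x : ℤ), ((a * b) ^ n) x = x - n := by
    intro n
    induction n with
    | zero => simp
    | succ n ih =>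
      intro x
      rw [pow_succ', Equiv.Perm.mul_apply, ih]
      simp [a, b]
      ring
  obtain ⟨n, rfl | rfl⟩ := k.eq_nat_or_neg
  · have := hz n 0
    rw [zpow_natCast] at h2
    rw [h2] at this
    simpa using this
  · have := hz n 0
    rw [zpow_neg, zpow_natCast, inv_eq_one] at h2
    rw [h2] at this
    simpa using this

theorem eta_hom_exists (hra : RA M) : ∃ η : W → W → ZMod 2,
    (∀ t, η 1 t = 0) ∧ (∀ i, η (cs.simple i) (cs.simple i) = 1) ∧
    (∀ i t, t ≠ cs.simple i → η (cs.simple i) t = 0) ∧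
    (∀ u v t, η (u * v) t = η v t + η u (v * t * v⁻¹)) := by
  classical
  let f : B → Function.End (W × ZMod 2) := fun i p =>
    (cs.simple i * p.1 * cs.simple i, p.2 + if p.1 = cs.simple i then 1 else 0)
  have hcj : ∀ i t, cs.simple i * t * cs.simple i = cs.simple i ↔ t = cs.simple i := by
    intro i t
    constructor
    · intro h
      have := congrArg (fun x => cs.simple i * x * cs.simple i) h
      simpa [mul_assoc] using this
    · rintro rfl; simp
  have hsq : ∀ i, f i * f i = 1 := by
    intro i
    funext p
    change f i (f i p) = p
    ext
    · simp [f, mul_assoc]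
    · simp only [f, hcj]
      split_ifs
      · rw [add_assoc]; simp; exact (by decide)
      · simp
  have hl : M.IsLiftable f := by
    intro i j
    by_cases h : i = j
    · subst h
      rw [M.diagonal, pow_one, hsq]
    · rcases hra i j h with h2 | h2 <;> rw [h2]
      · have hc := comm_of_two cs h2
        have hjs : ∀ t, cs.simple j * t * cs.simple j = cs.simple i ↔ t = cs.simple i := by
          intro t
          constructor
          · intro h
            have := congrArg (fun x => cs.simple j * x * cs.simple j) h
            simpa [mul_assoc, hc] using this
          · rintro rfl; rw [← hc]; simp
        have his : ∀ t, cs.simple i * t * cs.simple i = cs.simple j ↔ t = cs.simple j := by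
          intro t
          constructor
          · intro h
            have := congrArg (fun x => cs.simple i * x * cs.simple i) h
            simpa [mul_assoc, ← hc] using this
          · rintro rfl; rw [hc]; simp
        have hcomm : f i * f j = f j * f i := by
          funext p
          change f i (f j p) = f j (f i p)
          ext
          · simp only [f]
            calc cs.simple i * (cs.simple j * p.1 * cs.simple j) * cs.simple i
                = (cs.simple i * cs.simple j) * p.1 * (cs.simple j * cs.simple i) := by group
              _ = (cs.simple j * cs.simple i) * p.1 * (cs.simple i * cs.simple j) := by rw [hc]
              _ = _ := by group
          · simp only [f, hjs, his]
            ring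
        rw [pow_two]
        calc f i * f j * (f i * f j) = f i * (f j * f i) * f j := by simp only [mul_assoc]
          _ = (f i * f i) * (f j * f j) := by rw [← hcomm]; simp only [mul_assoc]
          _ = 1 := by rw [hsq, hsq, one_mul]
      · simp
  let N := cs.lift ⟨f, hl⟩
  have hN : ∀ i, N (cs.simple i) = f i := fun i => cs.lift_apply_simple hl i
  have hNm : ∀ u v p, N (u * v) p = N u (N v p) := by
    intro u v p; rw [map_mul]; rfl
  have hN1 : ∀ p, N 1 p = p := by intro p; rw [map_one]; rfl
  have key : ∀ w t e, N w (t, e) = (w * t * w⁻¹, e + (N w (t, 0)).2) := by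
    intro w
    induction w using cs.simple_induction_left with
    | one => intro t e; simp [hN1]
    | mul_simple_left w i ih =>
      intro t e
      rw [hNm, hNm, ih t e, ih t 0, hN]
      simp [f, mul_assoc, add_assoc]
  refine ⟨fun w t => (N w (t, 0)).2, ?_, ?_, ?_, ?_⟩
  · intro t; simp [hN1]
  · intro i; simp [hN, f]
  · intro i t h; simp [hN, f, h]
  · intro u v t
    simp only
    rw [hNm, key v t 0, key u]

theorem zmod2 (x : ZMod 2) : x = 0 ∨ x = 1 := by
  revert x; decide

theorem dihedral_form {i j : B} {u : W}
    (hu : u ∈ Subgroup.closure {cs.simple i, cs.simple j}) :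
    ∃ k : ℤ, u = (cs.simple i * cs.simple j) ^ k ∨
      u = (cs.simple i * cs.simple j) ^ k * cs.simple i := by
  set ρ := cs.simple i * cs.simple j with hρ
  have hi : cs.simple i * ρ * (cs.simple i)⁻¹ = ρ⁻¹ := by
    simp [hρ]
  have hc : ∀ k : ℤ, cs.simple i * ρ ^ k = ρ ^ (-k) * cs.simple i := by
    intro k
    have := conj_zpow (i := k) (a := cs.simple i) (b := ρ)
    rw [hi, inv_zpow'] at this
    rw [this]; simp [mul_assoc]
  have hj : cs.simple j = cs.simple i * ρ := by simp [hρ]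
  have hs1 : ∀ v, (∃ k : ℤ, v = ρ ^ k ∨ v = ρ ^ k * cs.simple i) →
      ∃ k : ℤ, cs.simple i * v = ρ ^ k ∨ cs.simple i * v = ρ ^ k * cs.simple i := by
    rintro v ⟨k, rfl | rfl⟩
    · exact ⟨-k, Or.inr (hc k)⟩
    · exact ⟨-k, Or.inl (by rw [← mul_assoc, hc, mul_assoc]; simp)⟩
  have hs2 : ∀ v, (∃ k : ℤ, v = ρ ^ k ∨ v = ρ ^ k * cs.simple i) →
      ∃ k : ℤ, cs.simple j * v = ρ ^ k ∨ cs.simple j * v = ρ ^ k * cs.simple i := by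
    rintro v ⟨k, rfl | rfl⟩
    · rw [hj, mul_assoc]
      exact hs1 _ ⟨1 + k, Or.inl (by rw [zpow_add, zpow_one])⟩
    · rw [hj, mul_assoc]
      exact hs1 _ ⟨1 + k, Or.inr (by rw [zpow_add, zpow_one]; simp only [hρ, mul_assoc])⟩
  induction hu using Subgroup.closure_induction_left with
  | one => exact ⟨0, Or.inl (by simp)⟩
  | mul_left x hx y hy ih =>
    rcases hx with rfl | rfl
    · exact hs1 _ ih
    · exact hs2 _ ih
  | inv_mul_cancel x hx y hy ih =>
    rcases hx with rfl | rfl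
    · rw [cs.inv_simple]; exact hs1 _ ih
    · rw [cs.inv_simple]; exact hs2 _ ih

theorem dihedral_centralizer (hra : RA M) {i j : B} (h : i ≠ j) (hM : M i j = 0) {u : W}
    (hu : u ∈ Subgroup.closure {cs.simple i, cs.simple j})
    (hc : u * cs.simple i * u⁻¹ = cs.simple i) : u = 1 ∨ u = cs.simple i := by
  obtain ⟨k, hk⟩ := dihedral_form cs hu
  set ρ := cs.simple i * cs.simple j with hρ
  have hi : cs.simple i * ρ * (cs.simple i)⁻¹ = ρ⁻¹ := by
    simp [hρ]
  have hcc : cs.simple i * ρ ^ k * (cs.simple i)⁻¹ = ρ ^ (-k) := by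
    have := conj_zpow (i := k) (a := cs.simple i) (b := ρ)
    rw [hi, inv_zpow'] at this
    exact this.symm
  have h1 : ρ ^ k * cs.simple i = cs.simple i * ρ ^ k := by
    rcases hk with rfl | rfl
    · rw [mul_inv_eq_iff_eq_mul] at hc; exact hc
    · rw [mul_inv_eq_iff_eq_mul] at hc
      have := congrArg (· * cs.simple i) hc
      simpa [mul_assoc] using this
  rw [← h1, mul_assoc, mul_inv_cancel, mul_one] at hcc
  have : ρ ^ (k + k) = 1 := by
    rw [zpow_add]; nth_rewrite 1 [hcc]; rw [← zpow_add]; simp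
  have hk0 : k = 0 := by
    have := pow_ne cs hra h hM this
    omega
  subst hk0
  simpa using hk

/-- The two descent lemmas. -/
theorem descents (hra : RA M) {w : W} {i j : B} (h : i ≠ j)
    (hi : cs.IsRightDescent w i) (hj : cs.IsRightDescent w j) :
    cs.simple i * cs.simple j = cs.simple j * cs.simple i ∧
      cs.IsRightDescent (w * cs.simple i) j := by
  classical
  obtain ⟨η, h1, hs, hn, hm⟩ := eta_hom_exists cs hra
  have hword : ∀ (ω : List B) t, t ∉ cs.rightInvSeq ω → η (cs.wordProd ω) t = 0 := by
    intro ω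
    induction ω with
    | nil => intro t _; simp [h1]
    | cons k ω ih =>
      intro t ht
      rw [CoxeterSystem.rightInvSeq, List.mem_cons, not_or] at ht
      rw [cs.wordProd_cons, hm, ih t ht.2, zero_add, hn]
      intro he
      apply ht.1
      rw [← he]; group
  have hlt : ∀ w t, η w t = 1 → cs.length (w * t) < cs.length w := by
    intro w t ht
    obtain ⟨ω, hω, rfl⟩ := cs.exists_isReduced w
    by_cases hmem : t ∈ cs.rightInvSeq ω
    · exact (cs.isRightInversion_of_mem_rightInvSeq hω hmem).2
    · rw [hword ω t hmem] at ht; exact absurd ht (by decide)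
  have hdesc : ∀ w k, cs.IsRightDescent w k → η w (cs.simple k) = 1 := by
    intro w k hd
    rcases zmod2 (η w (cs.simple k)) with h0 | h0
    · have : η (w * cs.simple k) (cs.simple k) = 1 := by
        rw [hm, hs]; simp [h0]
      have := hlt _ _ this
      rw [cs.simple_mul_simple_cancel_right] at this
      unfold CoxeterSystem.IsRightDescent at hd
      omega
    · exact h0
  have hcom : cs.simple i * cs.simple j = cs.simple j * cs.simple i := by
    rcases hra i j h with hM | hM
    · exact comm_of_two cs hM
    · exfalso
      have hM' : M j i = 0 := by rw [M.symmetric]; exact hM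
      let D := Subgroup.closure {cs.simple i, cs.simple j}
      have hDi : cs.simple i ∈ D := Subgroup.subset_closure (by simp)
      have hDj : cs.simple j ∈ D := Subgroup.subset_closure (by simp)
      have hR : ∀ u ∈ D, ¬ (η u (cs.simple i) = 1 ∧ η u (cs.simple j) = 1) := by
        have hsi : ∀ v ∈ D, ¬ (η v (cs.simple i) = 1 ∧ η v (cs.simple j) = 1) →
            ¬ (η (cs.simple i * v) (cs.simple i) = 1 ∧ η (cs.simple i * v) (cs.simple j) = 1) := by
          intro v hv ih
          rw [hm, hm, hn i _ (conj_simple_ne cs hra h.symm v), add_zero]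
          by_cases hc : v * cs.simple i * v⁻¹ = cs.simple i
          · rcases dihedral_centralizer cs hra h hM hv hc with rfl | rfl
            · simp [h1]
            · simp [hn i _ (simple_ne cs hra h.symm)]
          · rw [hn i _ hc, add_zero]; exact ih
        have hsj : ∀ v ∈ D, ¬ (η v (cs.simple i) = 1 ∧ η v (cs.simple j) = 1) →
            ¬ (η (cs.simple j * v) (cs.simple i) = 1 ∧ η (cs.simple j * v) (cs.simple j) = 1) := by
          intro v hv ih
          rw [hm, hm, hn j _ (conj_simple_ne cs hra h v), add_zero]
          by_cases hc : v * cs.simple j * v⁻¹ = cs.simple j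
          · have hv' : v ∈ Subgroup.closure {cs.simple j, cs.simple i} := by
              rw [Set.pair_comm]; exact hv
            rcases dihedral_centralizer cs hra h.symm hM' hv' hc with rfl | rfl
            · simp [h1]
            · simp [hn j _ (simple_ne cs hra h)]
          · rw [hn j _ hc, add_zero]; exact ih
        intro u hu
        induction hu using Subgroup.closure_induction_left with
        | one => simp [h1]
        | mul_left x hx y hy ih =>
          rcases hx with rfl | rfl
          · exact hsi _ hy ih
          · exact hsj _ hy ih
        | inv_mul_cancel x hx y hy ih =>
          rcases hx with rfl | rfl
          · rw [cs.inv_simple]; exact hsi _ hy ih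
          · rw [cs.inv_simple]; exact hsj _ hy ih
      -- minimal coset representative
      obtain ⟨a, ⟨u, hu, rfl⟩, hmin⟩ : ∃ a, (∃ u ∈ D, w * u = a) ∧
          ∀ v ∈ D, cs.length a ≤ cs.length (a * v) := by
        have hne : ∃ k, ∃ u ∈ D, cs.length (w * u) = k := ⟨_, 1, D.one_mem, rfl⟩
        obtain ⟨u, hu, hk⟩ := Nat.find_spec hne
        refine ⟨w * u, ⟨u, hu, rfl⟩, fun v hv => ?_⟩
        rw [hk]
        exact Nat.find_min' hne ⟨u * v, D.mul_mem hu hv, by rw [mul_assoc]⟩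
      have hzero : ∀ t ∈ D, η (w * u) t = 0 := by
        intro t ht
        rcases zmod2 (η (w * u) t) with h0 | h0
        · exact h0
        · have := hlt _ _ h0
          have := hmin t ht
          omega
      have hred : ∀ t ∈ D, η w t = η u⁻¹ t := by
        intro t ht
        have : w = (w * u) * u⁻¹ := by group
        rw [this, hm, hzero _ (D.mul_mem (D.mul_mem (D.inv_mem hu) ht) (D.inv_mem (D.inv_mem hu))),
          add_zero]
      apply hR u⁻¹ (D.inv_mem hu)
      rw [← hred _ hDi, ← hred _ hDj]
      exact ⟨hdesc _ _ hi, hdesc _ _ hj⟩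
  refine ⟨hcom, hlt _ _ ?_⟩
  rw [hm, hn i _ (simple_ne cs hra h.symm), zero_add, cs.inv_simple, hcom,
    cs.simple_mul_simple_cancel_right, hdesc _ _ hj]

end Cox

section Bld

variable {B : Type*} {W : Type*} [Group W] {M : CoxeterMatrix B} {cs : CoxeterSystem M W}
  {Δ : Type*} {δ : Δ → Δ → W}

/-- All hypotheses on the building, bundled. -/
structure Bldg (cs : CoxeterSystem M W) (δ : Δ → Δ → W) : Prop where
  wd1 : ∀ C D : Δ, δ C D = 1 ↔ C = D
  wd2 : ∀ (C C' D : Δ) (i : B), δ C' C = cs.simple i →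
      (δ C' D = cs.simple i * δ C D ∨ δ C' D = δ C D) ∧
      (cs.length (cs.simple i * δ C D) = cs.length (δ C D) + 1 →
        δ C' D = cs.simple i * δ C D)
  wd3 : ∀ (C D : Δ) (i : B), ∃ C' : Δ,
      δ C' C = cs.simple i ∧ δ C' D = cs.simple i * δ C D
  ra : RA M
  fin : ∀ (i : B) (C : Δ), {D : Δ | δ C D = 1 ∨ δ C D = cs.simple i}.Finite
  reg : ∀ (i : B) (C D : Δ),
      {D' : Δ | δ C D' = 1 ∨ δ C D' = cs.simple i}.ncard =
        {D' : Δ | δ D D' = 1 ∨ δ D D' = cs.simple i}.ncard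

/-- Galleries of a given type. -/
def gal (cs : CoxeterSystem M W) (δ : Δ → Δ → W) : List B → Δ → Δ → Prop
  | [], C, D => C = D
  | i :: ω, C, D => ∃ C', δ C C' = cs.simple i ∧ gal cs δ ω C' D

namespace Bldg

variable (h : Bldg cs δ)
include h

theorem self (C : Δ) : δ C C = 1 := (h.wd1 C C).2 rfl

theorem adj_symm {C D : Δ} {i : B} (hs : δ C D = cs.simple i) : δ D C = cs.simple i := by
  rcases (h.wd2 D C C i hs).1 with h1 | h1
  · rw [h.self] at h1
    have := eq_inv_of_mul_eq_one_right h1.symm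
    rwa [cs.inv_simple] at this
  · rw [h.self] at h1
    have := (h.wd1 _ _).1 h1.symm
    rw [this, h.self] at hs
    exact absurd hs.symm (simple_ne_one cs i)

theorem gal_of_eq (ω : List B) : ∀ C D, δ C D = cs.wordProd ω → gal cs δ ω C D := by
  induction ω with
  | nil => intro C D hD; exact (h.wd1 _ _).1 (by simpa using hD)
  | cons i ω ih =>
    intro C D hD
    obtain ⟨C', h1, h2⟩ := h.wd3 C D i
    refine ⟨C', h.adj_symm h1, ih _ _ ?_⟩
    rw [h2, hD, cs.wordProd_cons, cs.simple_mul_simple_cancel_left]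

theorem eq_of_gal (ω : List B) : ∀ C D, cs.IsReduced ω → gal cs δ ω C D →
    δ C D = cs.wordProd ω := by
  induction ω with
  | nil => intro C D _ hD; simpa using (h.wd1 _ _).2 hD
  | cons i ω ih =>
    rintro C D hr ⟨C', h1, h2⟩
    have hr' : cs.IsReduced ω := by simpa using hr.drop 1
    have h3 := ih _ _ hr' h2
    rw [cs.wordProd_cons, ← h3]
    apply (h.wd2 C' C D i h1).2
    rw [h3, ← cs.wordProd_cons, hr.eq, hr'.eq]; rfl

omit h in
theorem gal_append (ω ω' : List B) : ∀ C D E, gal cs δ ω C D → gal cs δ ω' D E →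
    gal cs δ (ω ++ ω') C E := by
  induction ω with
  | nil => rintro C D E rfl h2; exact h2
  | cons i ω ih =>
    rintro C D E ⟨C', h1, h2⟩ h3
    exact ⟨C', h1, ih _ _ _ h2 h3⟩

theorem gal_reverse (ω : List B) : ∀ C D, gal cs δ ω C D → gal cs δ ω.reverse D C := by
  induction ω with
  | nil => rintro C D rfl; rfl
  | cons i ω ih =>
    rintro C D ⟨C', h1, h2⟩
    rw [List.reverse_cons]
    exact gal_append _ _ _ _ _ (ih _ _ h2) ⟨C, h.adj_symm h1, rfl⟩

theorem inv (C D : Δ) : δ D C = (δ C D)⁻¹ := by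
  obtain ⟨ω, hω, hw⟩ := cs.exists_isReduced (δ C D)
  rw [hw, ← cs.wordProd_reverse]
  exact h.eq_of_gal _ _ _ hω.reverse (h.gal_reverse _ _ _ (h.gal_of_eq _ _ _ hw))

theorem right2 {C D D' : Δ} {i : B} (hs : δ D D' = cs.simple i) :
    (δ C D' = δ C D * cs.simple i ∨ δ C D' = δ C D) ∧
    (¬ cs.IsRightDescent (δ C D) i → δ C D' = δ C D * cs.simple i) := by
  have h1 := h.wd2 D D' C i (h.adj_symm hs)
  rw [h.inv C D, h.inv C D'] at h1
  have e : cs.simple i * (δ C D)⁻¹ = (δ C D * cs.simple i)⁻¹ := by simp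
  rw [e, inv_inj, inv_inj, cs.length_inv, cs.length_inv] at h1
  refine ⟨h1.1, fun h2 => h1.2 ?_⟩
  exact cs.not_isRightDescent_iff.1 h2

theorem right3 (C D : Δ) (i : B) : ∃ D', δ D D' = cs.simple i ∧ δ C D' = δ C D * cs.simple i := by
  obtain ⟨D', h1, h2⟩ := h.wd3 D C i
  refine ⟨D', h.adj_symm h1, ?_⟩
  rw [h.inv C D, h.inv C D'] at h2
  rw [← inv_inj, h2]; simp

theorem adj_trans {C D E : Δ} {i : B} (h1 : δ C D = cs.simple i) (h2 : δ D E = cs.simple i) :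
    C = E ∨ δ C E = cs.simple i := by
  rcases (h.right2 (C := C) h2).1 with h3 | h3
  · left; rw [h1, cs.simple_mul_simple_self] at h3; exact (h.wd1 _ _).1 h3
  · right; rw [h3, h1]

theorem square {A E D : Δ} {i j : B} (hij : i ≠ j)
    (hc : cs.simple i * cs.simple j = cs.simple j * cs.simple i)
    (h1 : δ A E = cs.simple i) (h2 : δ E D = cs.simple j) :
    ∃ X, δ A X = cs.simple j ∧ δ X D = cs.simple i := by
  have h3 : δ A D = cs.simple i * cs.simple j := by
    have := (h.wd2 E A D i h1).2
    rw [h2] at this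
    apply this
    rcases cs.length_simple_mul (cs.simple j) i with h4 | h4
    · exact h4
    · rw [cs.length_simple] at h4
      have h5 : cs.simple i * cs.simple j = 1 := cs.length_eq_zero_iff.1 (by omega)
      have := eq_inv_of_mul_eq_one_left h5
      rw [cs.inv_simple] at this
      exact absurd this (simple_ne cs h.ra hij)
  have h4 := h.gal_of_eq [j, i] A D (by simp [cs.wordProd_cons, h3, hc])
  obtain ⟨X, hX, Y, hY, rfl⟩ := h4
  exact ⟨X, hX, hY⟩

/-- existence of the downward neighbour. -/
theorem down_exists (C₀ : Δ) : ∃ d : Δ → B → Δ, ∀ C i,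
    δ C (d C i) = cs.simple i ∧ δ C₀ (d C i) = δ C₀ C * cs.simple i := by
  choose d hd using fun C i => h.right3 C₀ C i
  exact ⟨d, hd⟩

theorem step_inj {P : Δ} (Q : Δ) (i : B) : ∃ e : Δ → Δ,
    (∀ D, δ P D = cs.simple i → δ Q (e D) = cs.simple i) ∧
    ∀ D D', δ P D = cs.simple i → δ P D' = cs.simple i → e D = e D' → D = D' := by
  classical
  have hn : ∀ R : Δ, {D | δ R D = cs.simple i}.Finite ∧
      {D | δ R D = cs.simple i}.ncard + 1 = {D | δ R D = 1 ∨ δ R D = cs.simple i}.ncard := by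
    intro R
    have hf : {D | δ R D = cs.simple i}.Finite := (h.fin i R).subset (fun x hx => Or.inr hx)
    refine ⟨hf, ?_⟩
    have : {D | δ R D = 1 ∨ δ R D = cs.simple i} = insert R {D | δ R D = cs.simple i} := by
      ext D
      simp only [Set.mem_ofPred_eq, Set.mem_insert_iff, h.wd1]
      tauto
    rw [this, Set.ncard_insert_of_notMem _ hf]
    intro hR
    have hR' : δ R R = cs.simple i := hR
    rw [h.self] at hR'
    exact simple_ne_one cs i hR'.symm
  have hle : {D | δ P D = cs.simple i}.encard ≤ {D | δ Q D = cs.simple i}.encard := by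
    rw [← (hn P).1.cast_ncard_eq, ← (hn Q).1.cast_ncard_eq]
    have := (hn P).2
    have h2 := (hn Q).2
    rw [h.reg i P Q] at this
    exact_mod_cast (by omega)
  have : Nonempty Δ := ⟨P⟩
  obtain ⟨e, he1, he2⟩ := (hn P).1.exists_injOn_of_encard_le hle
  exact ⟨e, fun D hD => he1 hD, fun D D' hD hD' hh => he2 hD hD' hh⟩

section Down

variable {C₀ : Δ} {d : Δ → B → Δ}
  (hd : ∀ C i, δ C (d C i) = cs.simple i ∧ δ C₀ (d C i) = δ C₀ C * cs.simple i)
include hd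

theorem d_unique {C D : Δ} {i : B} (hi : cs.IsRightDescent (δ C₀ C) i)
    (h1 : δ C D = cs.simple i) (h2 : δ C₀ D = δ C₀ C * cs.simple i) : d C i = D := by
  rcases h.adj_trans (h.adj_symm (hd C i).1) h1 with h3 | h3
  · exact h3
  · exfalso
    have := (h.right2 (C := C₀) h3).2
    rw [(hd C i).2, h2] at this
    have h4 := this (cs.isRightDescent_iff_not_isRightDescent_mul.1 hi)
    have h5 := simple_ne_one cs i
    exact h5 (by simpa using h4)

theorem d_desc {C : Δ} {i j : B} (hij : i ≠ j) (hi : cs.IsRightDescent (δ C₀ C) i)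
    (hj : cs.IsRightDescent (δ C₀ C) j) : cs.IsRightDescent (δ C₀ (d C i)) j := by
  rw [(hd C i).2]
  exact (descents cs h.ra hij hi hj).2

theorem d_comm {C : Δ} {i j : B} (hij : i ≠ j) (hi : cs.IsRightDescent (δ C₀ C) i)
    (hj : cs.IsRightDescent (δ C₀ C) j) : d (d C i) j = d (d C j) i := by
  have hc := (descents cs h.ra hij hi hj).1
  obtain ⟨X, hX1, hX2⟩ := h.square hij hc (hd C i).1 (hd (d C i) j).1
  have hw : δ C₀ (d (d C i) j) = δ C₀ C * cs.simple j * cs.simple i := by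
    rw [(hd _ _).2, (hd _ _).2, mul_assoc, hc, mul_assoc]
  have hdi := h.d_desc hd hij.symm hj hi
  have hXw : δ C₀ X = δ C₀ C * cs.simple j := by
    have := (h.right2 (C := C₀) (h.adj_symm hX2)).2
    rw [hw, cs.simple_mul_simple_cancel_right] at this
    apply this
    rw [(hd C j).2] at hdi
    exact cs.isRightDescent_iff_not_isRightDescent_mul.1 hdi
  have hXd := h.d_unique hd hj hX1 hXw
  subst hXd
  exact (h.d_unique hd hdi hX2 (by rw [hw, (hd C j).2])).symm

/-- Two chambers with the same weight and the same two downward neighbours are equal. -/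
theorem eq_of_d {C D : Δ} {i j : B} (hij : i ≠ j) (h1 : d C i = d D i) (h2 : d C j = d D j) :
    C = D := by
  rcases h.adj_trans (hd C i).1 (h1 ▸ h.adj_symm (hd D i).1) with h3 | h3
  · exact h3
  rcases h.adj_trans (hd C j).1 (h2 ▸ h.adj_symm (hd D j).1) with h4 | h4
  · exact h4
  · exact absurd (h3.symm.trans h4) (simple_ne cs h.ra hij)

theorem same_level {C D : Δ} {i : B} (h1 : δ C D = cs.simple i) (hw : δ C₀ C = δ C₀ D) :
    cs.IsRightDescent (δ C₀ C) i ∧ d C i = d D i := by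
  have hi : cs.IsRightDescent (δ C₀ C) i := by
    by_contra hcon
    have := (h.right2 (C := C₀) h1).2 hcon
    rw [← hw] at this
    exact simple_ne_one cs i (by simpa using this)
  refine ⟨hi, ?_⟩
  have h2 : δ C₀ (d D i) = δ C₀ C * cs.simple i := by rw [(hd D i).2, hw]
  rcases h.adj_trans h1 (hd D i).1 with h3 | h3
  · rw [← h3] at h2
    exact absurd (by simpa using h2) (simple_ne_one cs i)
  · exact h.d_unique hd hi h3 h2

theorem same_level_down {C D : Δ} {i j : B} (hij : i ≠ j) (h1 : δ C D = cs.simple i)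
    (hw : δ C₀ C = δ C₀ D) (hj : cs.IsRightDescent (δ C₀ C) j) :
    δ (d C j) (d D j) = cs.simple i := by
  obtain ⟨hi, hP⟩ := h.same_level hd h1 hw
  have e1 := h.d_comm hd hij hi hj
  have e2 := h.d_comm hd hij (hw ▸ hi) (hw ▸ hj)
  have e3 : d (d C j) i = d (d D j) i := by rw [← e1, ← e2, hP]
  rcases h.adj_trans (hd (d C j) i).1 (e3 ▸ h.adj_symm (hd (d D j) i).1) with h3 | h3
  · have := h.eq_of_d hd hij hP h3
    rw [this, h.self] at h1
    exact absurd h1.symm (simple_ne_one cs i)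
  · exact h3

/-- `f` is a good partial map on the ball of radius `m`. -/
def Good (cs : CoxeterSystem M W) (δ : Δ → Δ → W) (C₀ : Δ) (m : ℕ) (f : Δ → Δ) : Prop :=
  (∀ C, cs.length (δ C₀ C) < m → δ C₀ (f C) = δ C₀ C) ∧
  ∀ C D i, cs.length (δ C₀ C) < m → cs.length (δ C₀ D) < m → δ C D = cs.simple i →
    δ (f C) (f D) = cs.simple i

omit h in
theorem d_length {C : Δ} {i : B} (hi : cs.IsRightDescent (δ C₀ C) i) :
    cs.length (δ C₀ (d C i)) < cs.length (δ C₀ C) := by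
  rw [(hd C i).2]; exact hi

theorem good_d {m : ℕ} {f : Δ → Δ} (hf : Good cs δ C₀ m f) {C : Δ} {i : B}
    (hC : cs.length (δ C₀ C) < m) (hi : cs.IsRightDescent (δ C₀ C) i) :
    d (f C) i = f (d C i) := by
  have hl := d_length hd hi
  apply h.d_unique hd
  · rwa [hf.1 C hC]
  · exact hf.2 _ _ _ hC (hl.trans hC) (hd C i).1
  · rw [hf.1 C hC, hf.1 _ (hl.trans hC), (hd C i).2]

theorem up_weight {m : ℕ} {f : Δ → Δ} (hf : Good cs δ C₀ m f) {C X : Δ} {i : B}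
    (hC : cs.length (δ C₀ C) ≤ m) (hi : cs.IsRightDescent (δ C₀ C) i)
    (hX : δ X (f (d C i)) = cs.simple i) : δ C₀ X = δ C₀ C ∧ d X i = f (d C i) := by
  have hl := d_length hd hi
  have hw : δ C₀ (f (d C i)) = δ C₀ C * cs.simple i := by
    rw [hf.1 _ (hl.trans_le hC), (hd C i).2]
  have h1 : δ C₀ X = δ C₀ C := by
    have := (h.right2 (C := C₀) (h.adj_symm hX)).2
    rw [hw, cs.simple_mul_simple_cancel_right] at this
    exact this (cs.isRightDescent_iff_not_isRightDescent_mul.1 hi)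
  refine ⟨h1, h.d_unique hd (h1 ▸ hi) hX (by rw [hw, h1])⟩

theorem extend_point {m : ℕ} {f : Δ → Δ} (hf : Good cs δ C₀ m f)
    {e : Δ → B → Δ → Δ}
    (he : ∀ P i D, δ P D = cs.simple i → δ (f P) (e P i D) = cs.simple i)
    (C : Δ) (hC : cs.length (δ C₀ C) ≤ m) : ∃ X,
      (∀ i, cs.IsRightDescent (δ C₀ C) i → δ X (f (d C i)) = cs.simple i) ∧
      ∀ i, cs.IsRightDescent (δ C₀ C) i → (∀ j, cs.IsRightDescent (δ C₀ C) j → j = i) →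
        X = e (d C i) i C := by
  by_cases h0 : ∃ i, cs.IsRightDescent (δ C₀ C) i
  swap
  · exact ⟨C, fun i hi => absurd ⟨i, hi⟩ h0, fun i hi => absurd ⟨i, hi⟩ h0⟩
  obtain ⟨i, hi⟩ := h0
  by_cases h1 : ∀ j, cs.IsRightDescent (δ C₀ C) j → j = i
  · refine ⟨e (d C i) i C, ?_, ?_⟩
    · intro j hj
      rw [h1 j hj]
      exact h.adj_symm (he _ _ _ (h.adj_symm (hd C i).1))
    · intro j hj _
      rw [h1 j hj]
  push Not at h1
  obtain ⟨j, hj, hji⟩ := h1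
  have hij := hji.symm
  have hlt : ∀ k, cs.IsRightDescent (δ C₀ C) k → cs.length (δ C₀ (d C k)) < m :=
    fun k hk => (d_length hd hk).trans_le hC
  have hc := (descents cs h.ra hij hi hj).1
  have hij' := h.d_desc hd hij hi hj
  have hji' := h.d_desc hd hji hj hi
  have a1 : δ (f (d C i)) (f (d (d C i) j)) = cs.simple j :=
    hf.2 _ _ _ (hlt i hi) ((d_length hd hij').trans (hlt i hi)) (hd _ _).1
  have a2 : δ (f (d C j)) (f (d (d C i) j)) = cs.simple i := by
    rw [h.d_comm hd hij hi hj]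
    exact hf.2 _ _ _ (hlt j hj) ((d_length hd hji').trans (hlt j hj)) (hd _ _).1
  obtain ⟨X, hX1, hX2⟩ := h.square hji hc.symm a1 (h.adj_symm a2)
  have hX1' := h.adj_symm hX1
  obtain ⟨hw, hXi⟩ := h.up_weight hd hf hC hi hX1'
  obtain ⟨-, hXj⟩ := h.up_weight hd hf hC hj hX2
  refine ⟨X, ?_, ?_⟩
  · intro k hk
    by_cases hki : k = i
    · subst hki; exact hX1'
    by_cases hkj : k = j
    · subst hkj; exact hX2
    have key : ∀ l, cs.IsRightDescent (δ C₀ C) l → k ≠ l → d X l = f (d C l) →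
        d (d X k) l = d (f (d C k)) l := by
      intro l hl hkl hXl
      rw [h.d_comm hd hkl (hw ▸ hk) (hw ▸ hl), hXl,
        h.good_d hd hf (hlt l hl) (h.d_desc hd (Ne.symm hkl) hl hk),
        h.good_d hd hf (hlt k hk) (h.d_desc hd hkl hk hl), h.d_comm hd hkl hk hl]
    rw [← h.eq_of_d hd hij (key i hi hki hXi) (key j hj hkj hXj)]
    exact (hd X k).1
  · intro k hk hu
    exact absurd ((hu i hi).trans (hu j hj).symm) hij

theorem extend_step {m : ℕ} {f : Δ → Δ} (hf : Good cs δ C₀ m f) :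
    ∃ f', Good cs δ C₀ (m + 1) f' ∧ ∀ C, cs.length (δ C₀ C) < m → f' C = f C := by
  classical
  choose e he1 he2 using fun P i => h.step_inj (P := P) (f P) i
  choose x hx1 hx2 using fun C (hC : cs.length (δ C₀ C) ≤ m) => h.extend_point hd hf he1 C hC
  by_cases hm : m = 0
  · subst hm
    have h0 : ∀ C, cs.length (δ C₀ C) < 0 + 1 → C₀ = C := by
      intro C hC
      exact (h.wd1 _ _).1 (cs.length_eq_zero_iff.1 (by omega))
    refine ⟨id, ⟨fun C _ => rfl, fun C D i _ _ hh => hh⟩, fun C hC => absurd hC (by omega)⟩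
  let f' : Δ → Δ := fun C => if hC : cs.length (δ C₀ C) = m then x C hC.le else f C
  have f'lt : ∀ C, cs.length (δ C₀ C) < m → f' C = f C := fun C hC => dif_neg hC.ne
  have f'eq : ∀ C (hC : cs.length (δ C₀ C) = m), f' C = x C hC.le := fun C hC => dif_pos hC
  refine ⟨f', ⟨?_, ?_⟩, f'lt⟩
  · intro C hC
    rcases Nat.lt_succ_iff_lt_or_eq.1 hC with hC | hC
    · rw [f'lt C hC, hf.1 C hC]
    · rw [f'eq C hC]
      have hne : δ C₀ C ≠ 1 := by
        intro hh; rw [hh, cs.length_one] at hC; exact hm hC.symm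
      obtain ⟨i, hi⟩ := cs.exists_rightDescent_of_ne_one hne
      exact (h.up_weight hd hf hC.le hi (hx1 C hC.le i hi)).1
  · have mixed : ∀ C D i, cs.length (δ C₀ C) = m → cs.length (δ C₀ D) < m →
        δ C D = cs.simple i → δ (f' C) (f' D) = cs.simple i := by
      intro C D i hC hD hs
      rw [f'eq C hC, f'lt D hD]
      have hw : δ C₀ D = δ C₀ C * cs.simple i := by
        rcases (h.right2 (C := C₀) hs).1 with h1 | h1
        · exact h1
        · rw [h1] at hD; omega
      have hi : cs.IsRightDescent (δ C₀ C) i := by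
        unfold CoxeterSystem.IsRightDescent
        rw [← hw, hC]; exact hD
      rw [← h.d_unique hd hi hs hw]
      exact hx1 C hC.le i hi
    intro C D i hC hD hs
    rcases Nat.lt_succ_iff_lt_or_eq.1 hC with hC | hC <;>
      rcases Nat.lt_succ_iff_lt_or_eq.1 hD with hD | hD
    · rw [f'lt C hC, f'lt D hD]; exact hf.2 _ _ _ hC hD hs
    · exact h.adj_symm (mixed D C i hD hC (h.adj_symm hs))
    · exact mixed C D i hC hD hs
    · have hw : δ C₀ C = δ C₀ D := by
        rcases (h.right2 (C := C₀) hs).1 with h1 | h1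
        · exfalso
          apply cs.length_mul_simple_ne (δ C₀ C) i
          rw [← h1, hC, hD]
        · exact h1.symm
      obtain ⟨hi, hP⟩ := h.same_level hd hs hw
      have hiD : cs.IsRightDescent (δ C₀ D) i := hw ▸ hi
      rw [f'eq C hC, f'eq D hD]
      have b1 := hx1 C hC.le i hi
      have b2 := hx1 D hD.le i hiD
      rw [← hP] at b2
      rcases h.adj_trans b1 (h.adj_symm b2) with h3 | h3
      swap
      · exact h3
      exfalso
      by_cases hu : ∀ j, cs.IsRightDescent (δ C₀ C) j → j = i
      · rw [hx2 C hC.le i hi hu, hx2 D hD.le i hiD (hw ▸ hu), ← hP] at h3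
        have := he2 _ _ _ _ (h.adj_symm (hd C i).1) (hP ▸ h.adj_symm (hd D i).1) h3
        rw [this, h.self] at hs
        exact simple_ne_one cs i hs.symm
      · push Not at hu
        obtain ⟨j, hj, hji⟩ := hu
        have hjD : cs.IsRightDescent (δ C₀ D) j := hw ▸ hj
        have c1 := h.same_level_down hd hji.symm hs hw hj
        have c2 := hf.2 _ _ _ ((d_length hd hj).trans_le hC.le)
          ((d_length hd hjD).trans_le hD.le) c1
        have c3 := (h.up_weight hd hf hC.le hj (hx1 C hC.le j hj)).2
        have c4 := (h.up_weight hd hf hD.le hjD (hx1 D hD.le j hjD)).2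
        rw [← c3, ← c4, h3, h.self] at c2
        exact simple_ne_one cs i c2.symm

end Down

theorem extend_all {C₀ : Δ} {n : ℕ} {f : Δ → Δ} (hf : Good cs δ C₀ n f) :
    ∃ G : Δ → Δ, (∀ C D i, δ C D = cs.simple i → δ (G C) (G D) = cs.simple i) ∧
      ∀ C, cs.length (δ C₀ C) < n → G C = f C := by
  obtain ⟨d, hd⟩ := h.down_exists C₀
  choose! E hE1 hE2 using fun m f (hf : Good cs δ C₀ m f) => h.extend_step hd hf
  let F : ℕ → Δ → Δ := fun k => Nat.rec f (fun k g => E (n + k) g) k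
  have hF : ∀ k, Good cs δ C₀ (n + k) (F k) := by
    intro k
    induction k with
    | zero => exact hf
    | succ k ih => exact hE1 _ _ ih
  have hFs : ∀ k C, cs.length (δ C₀ C) < n + k → F (k + 1) C = F k C :=
    fun k C hC => hE2 _ _ (hF k) C hC
  have hFa : ∀ k l C, cs.length (δ C₀ C) < n + k → F (k + l) C = F k C := by
    intro k l C hC
    induction l with
    | zero => rfl
    | succ l ih => rw [← add_assoc, hFs (k + l) C (by omega), ih]
  refine ⟨fun C => F (cs.length (δ C₀ C) + 1) C, ?_, ?_⟩
  · intro C D i hs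
    have e1 := hFa (cs.length (δ C₀ C) + 1) (cs.length (δ C₀ D) + 1) C (by omega)
    have e2 := hFa (cs.length (δ C₀ D) + 1) (cs.length (δ C₀ C) + 1) D (by omega)
    rw [add_comm] at e2
    simp only
    rw [← e1, ← e2]
    exact (hF (cs.length (δ C₀ C) + 1 + (cs.length (δ C₀ D) + 1))).2 _ _ _ (by omega) (by omega) hs
  · intro C hC
    have := hFa 0 (cs.length (δ C₀ C) + 1) C (by simpa using hC)
    rw [zero_add] at this
    exact this

theorem iso_of_adj {G : Δ → Δ} (hG : ∀ C D i, δ C D = cs.simple i → δ (G C) (G D) = cs.simple i) :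
    (∀ C D, δ (G C) (G D) = δ C D) ∧ Function.Bijective G := by
  have hgal : ∀ ω C D, gal cs δ ω C D → gal cs δ ω (G C) (G D) := by
    intro ω
    induction ω with
    | nil => rintro C D rfl; rfl
    | cons i ω ih =>
      rintro C D ⟨C', h1, h2⟩
      exact ⟨G C', hG _ _ _ h1, ih _ _ h2⟩
  have hδ : ∀ C D, δ (G C) (G D) = δ C D := by
    intro C D
    obtain ⟨ω, hω, hw⟩ := cs.exists_isReduced (δ C D)
    rw [hw]
    exact h.eq_of_gal _ _ _ hω (hgal _ _ _ (h.gal_of_eq _ _ _ hw))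
  have hinj : Function.Injective G := by
    intro C D hCD
    rw [← h.wd1, ← hδ, hCD, h.self]
  refine ⟨hδ, hinj, ?_⟩
  have hpan : ∀ C D i, δ (G C) D = cs.simple i → ∃ D', G D' = D := by
    intro C D i hD
    have hsub : G '' {X | δ C X = 1 ∨ δ C X = cs.simple i} ⊆
        {X | δ (G C) X = 1 ∨ δ (G C) X = cs.simple i} := by
      rintro _ ⟨X, hX, rfl⟩
      simpa [hδ] using hX
    have heq := Set.eq_of_subset_of_ncard_le hsub
      (by rw [Set.ncard_image_of_injective _ hinj, h.reg i C (G C)]) (h.fin i (G C))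
    have : D ∈ G '' {X | δ C X = 1 ∨ δ C X = cs.simple i} := by
      rw [heq]; exact Or.inr hD
    obtain ⟨D', -, hD'⟩ := this
    exact ⟨D', hD'⟩
  have hgs : ∀ ω C D, gal cs δ ω (G C) D → ∃ D', G D' = D := by
    intro ω
    induction ω with
    | nil => rintro C D hh; exact ⟨C, hh⟩
    | cons i ω ih =>
      rintro C D ⟨C', h1, h2⟩
      obtain ⟨X, rfl⟩ := hpan _ _ _ h1
      exact ih _ _ h2
  intro D
  obtain ⟨ω, hω, hw⟩ := cs.exists_isReduced (δ (G D) D)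
  exact hgs ω D D (h.gal_of_eq _ _ _ hw)

end Bldg

end Bld

end RAB


/-- Let `Δ` be a regular right angled building of type `(W, S)` in which
every panel is finite, `C₀ : Δ`, `n : ℕ` and `Bn = {C | ℓ(δ C₀ C) < n}`. Then every
automorphism of the combinatorial ball `Bn` fixing its center — i.e. every bijection
`g : Bn ≃ Bn` with `g C₀ = C₀` and `δ (g C) (g D) = δ C D` for all `C, D ∈ Bn` — extends to an
automorphism of the whole building: there is a bijection `G : Δ ≃ Δ` with
`δ (G C) (G D) = δ C D` for all chambers `C`, `D`, and `G C = g C` for all `C ∈ Bn`. -/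
theorem ball_automorphism_extends {B : Type*} {W : Type*} [Group W]
    {M : CoxeterMatrix B} (cs : CoxeterSystem M W)
    {Δ : Type*} [Nonempty Δ] (δ : Δ → Δ → W)
    (hWD1 : ∀ C D : Δ, δ C D = 1 ↔ C = D)
    (hWD2 : ∀ (C C' D : Δ) (i : B), δ C' C = cs.simple i →
      (δ C' D = cs.simple i * δ C D ∨ δ C' D = δ C D) ∧
      (cs.length (cs.simple i * δ C D) = cs.length (δ C D) + 1 →
        δ C' D = cs.simple i * δ C D))
    (hWD3 : ∀ (C D : Δ) (i : B), ∃ C' : Δ,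
      δ C' C = cs.simple i ∧ δ C' D = cs.simple i * δ C D)
    -- right angled
    (hra : ∀ i j : B, i ≠ j → M i j = 2 ∨ M i j = 0)
    -- all panels are finite
    (hfin : ∀ (i : B) (C : Δ), {D : Δ | δ C D = 1 ∨ δ C D = cs.simple i}.Finite)
    -- regular: for each `i`, all `i`-panels have the same cardinality
    (hreg : ∀ (i : B) (C D : Δ),
      {D' : Δ | δ C D' = 1 ∨ δ C D' = cs.simple i}.ncard =
        {D' : Δ | δ D D' = 1 ∨ δ D D' = cs.simple i}.ncard)
    (C₀ : Δ) (n : ℕ)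
    (Bn : Set Δ) (hBn : Bn = {C : Δ | cs.length (δ C₀ C) < n})
    (g : Bn ≃ Bn)
    (hgfix : ∀ h : C₀ ∈ Bn, g ⟨C₀, h⟩ = ⟨C₀, h⟩)
    (hgδ : ∀ C D : Bn, δ (g C : Δ) (g D : Δ) = δ (C : Δ) (D : Δ)) :
    ∃ G : Δ ≃ Δ, (∀ C D : Δ, δ (G C) (G D) = δ C D) ∧
      ∀ (C : Δ) (hC : C ∈ Bn), G C = (g ⟨C, hC⟩ : Δ) := by
  classical
  subst hBn
  have h : RAB.Bldg cs δ := ⟨hWD1, hWD2, hWD3, hra, hfin, hreg⟩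
  rcases Nat.eq_zero_or_pos n with rfl | hn
  · exact ⟨Equiv.refl Δ, fun _ _ => rfl, fun C hC => absurd hC (Nat.not_lt_zero _)⟩
  have h0 : cs.length (δ C₀ C₀) < n := by rw [h.self, cs.length_one]; exact hn
  let f : Δ → Δ := fun C => if hC : cs.length (δ C₀ C) < n then (g ⟨C, hC⟩ : Δ) else C
  have hfe : ∀ C (hC : cs.length (δ C₀ C) < n), f C = g ⟨C, hC⟩ := fun C hC => dif_pos hC
  have hf : RAB.Bldg.Good cs δ C₀ n f := by
    refine ⟨?_, ?_⟩
    · intro C hC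
      have h1 := hgδ ⟨C₀, h0⟩ ⟨C, hC⟩
      rw [hgfix h0] at h1
      rw [hfe C hC]
      exact h1
    · intro C D i hC hD hs
      rw [hfe C hC, hfe D hD, hgδ ⟨C, hC⟩ ⟨D, hD⟩]
      exact hs
  obtain ⟨G, hG1, hG2⟩ := h.extend_all hf
  obtain ⟨hG3, hG4⟩ := h.iso_of_adj hG1
  refine ⟨Equiv.ofBijective G hG4, hG3, ?_⟩
  intro C hC
  exact (hG2 C hC).trans (hfe C hC)
end
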